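/- Let b₁ ≥ b₂ ≥ 1 with h := b₁+b₂-1 ≥ 3, and let G be a connected graph on n ≥ 2h+4 vertices with minimum degree at least h that has at least one cut vertex. Then G contains P_{2b₁+1} ∪ P_{2b₂+1}, unless: (i) b₁ = b₂ + 1 and G = L_{t,h} = K_1 ∨ tK_h with n = th+1; or (ii) b₁ = b₂ and G is one of: U_{3,h} (n = 3h+3), a subgraph of L_{t₁,t₂,h,h+1} = K_1 ∨ (t₁K_h ∪ t₂K_{h+1}), a subgraph of F_{t₁,t₂,h,h+1}, or a subgraph of T_{t₁,t₂,h,h+1}. -/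

import Mathlib

open SimpleGraph

/-- `G` embeds into `H` as a (not necessarily induced) subgraph. -/
def SubgraphOf {V W : Type*} (G : SimpleGraph V) (H : SimpleGraph W) : Prop :=
  ∃ f : V ↪ W, ∀ a b, G.Adj a b → H.Adj (f a) (f b)

/-- `G` contains a linear forest consisting of pairwise vertex-disjoint paths
with orders `L i` (`i : ι`). -/
def ContainsForest {V ι : Type*} (G : SimpleGraph V) (L : ι → ℕ) : Prop :=
  ∃ f : ∀ i, Fin (L i) → V,
    (∀ i, Function.Injective (f i)) ∧
    (∀ i j, i ≠ j → ∀ a b, f i a ≠ f j b) ∧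
    (∀ i (a : ℕ) (ha : a + 1 < L i), G.Adj (f i ⟨a, by omega⟩) (f i ⟨a + 1, ha⟩))

/-- `G` is 2-connected: more than 2 vertices and removing fewer than 2 vertices
leaves a connected graph. -/
def TwoConnected {V : Type*} [Fintype V] (G : SimpleGraph V) : Prop :=
  2 < Fintype.card V ∧
    ∀ s : Finset V, s.card < 2 → (G.induce ((s : Set V)ᶜ)).Connected

/-- `S_{n,h} = K_h ∨ \overline{K_{n-h}}`. -/
def Sgraph (n h : ℕ) : SimpleGraph (Fin n) :=
  SimpleGraph.fromRel (fun a _ => a.val < h)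

/-- `S⁺_{n,h} = K_h ∨ (K_2 ∪ \overline{K_{n-h-2}})`, the extra edge joining vertices `h` and `h+1`. -/
def SplusGraph (n h : ℕ) : SimpleGraph (Fin n) :=
  SimpleGraph.fromRel (fun a b => a.val < h ∨ (a.val ≤ h + 1 ∧ b.val ≤ h + 1))

/-- index of the clique block containing vertex `v ≥ 1` in `K_1 ∨ (t₁ K_h ∪ t₂ K_{h+1})`. -/
def blockIdx (t₁ h v : ℕ) : ℕ :=
  if v - 1 < t₁ * h then (v - 1) / h else t₁ + (v - 1 - t₁ * h) / (h + 1)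

/-- `L_{t₁,t₂,h,h+1} = K_1 ∨ (t₁ K_h ∪ t₂ K_{h+1})`; vertex `0` is the center. -/
def Lgen (t₁ t₂ h : ℕ) : SimpleGraph (Fin (t₁ * h + t₂ * (h + 1) + 1)) :=
  SimpleGraph.fromRel (fun a b =>
    a.val = 0 ∨ blockIdx t₁ h a.val = blockIdx t₁ h b.val)

/-- `U_{3,h}`: three copies of `K_{h+1}` plus a triangle on one chosen vertex of each. -/
def Ugraph (h : ℕ) : SimpleGraph (Fin (3 * (h + 1))) :=
  SimpleGraph.fromRel (fun a b =>
    a.val / (h + 1) = b.val / (h + 1) ∨ (a.val % (h + 1) = 0 ∧ b.val % (h + 1) = 0))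

/-- `K_p ∨ (m K_2)`: a clique on the first `p` vertices joined to `m` disjoint edges. -/
def KjoinMK2 (p m : ℕ) : SimpleGraph (Fin (p + 2 * m)) :=
  SimpleGraph.fromRel (fun a b => a.val < p ∨ (a.val - p) / 2 = (b.val - p) / 2)

/-- `F_{t₁,t₂,h,h+1}`: `L_{t₁,t₂,h,h+1}` plus one extra `K_{h+1}` joined to the center by an edge. -/
def Fgraph (t₁ t₂ h : ℕ) : SimpleGraph (Fin (t₁ * h + (t₂ + 1) * (h + 1) + 1)) :=
  SimpleGraph.fromRel (fun a b =>
    (a.val < t₁ * h + t₂ * (h + 1) + 1 ∧ b.val < t₁ * h + t₂ * (h + 1) + 1 ∧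
      (a.val = 0 ∨ blockIdx t₁ h a.val = blockIdx t₁ h b.val)) ∨
    (t₁ * h + t₂ * (h + 1) + 1 ≤ a.val ∧ t₁ * h + t₂ * (h + 1) + 1 ≤ b.val) ∨
    (a.val = 0 ∧ b.val = t₁ * h + t₂ * (h + 1) + 1))

/-- `T_{t₁,t₂,h,h+1}`: `L_{t₁,t₂,h,h+1}` plus two extra `K_{h+1}`'s, each joined to the center by an edge. -/
def Tgraph (t₁ t₂ h : ℕ) : SimpleGraph (Fin (t₁ * h + (t₂ + 2) * (h + 1) + 1)) :=
  SimpleGraph.fromRel (fun a b =>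
    (a.val < t₁ * h + t₂ * (h + 1) + 1 ∧ b.val < t₁ * h + t₂ * (h + 1) + 1 ∧
      (a.val = 0 ∨ blockIdx t₁ h a.val = blockIdx t₁ h b.val)) ∨
    (t₁ * h + t₂ * (h + 1) + 1 ≤ a.val ∧ a.val < t₁ * h + (t₂ + 1) * (h + 1) + 1 ∧
      t₁ * h + t₂ * (h + 1) + 1 ≤ b.val ∧ b.val < t₁ * h + (t₂ + 1) * (h + 1) + 1) ∨
    (t₁ * h + (t₂ + 1) * (h + 1) + 1 ≤ a.val ∧ t₁ * h + (t₂ + 1) * (h + 1) + 1 ≤ b.val) ∨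
    (a.val = 0 ∧ b.val = t₁ * h + t₂ * (h + 1) + 1) ∨
    (a.val = 0 ∧ b.val = t₁ * h + (t₂ + 1) * (h + 1) + 1))

/-- attach a pendant path with `m` additional vertices at the vertex `u` of `H`
(i.e. identify `u` with an endpoint of `P_{m+1}`). -/
def attachPath {V : Type*} (H : SimpleGraph V) (u : V) (m : ℕ) : SimpleGraph (V ⊕ Fin m) :=
  SimpleGraph.fromRel (fun a b =>
    (∃ x y, a = Sum.inl x ∧ b = Sum.inl y ∧ H.Adj x y) ∨
    (∃ j : Fin m, a = Sum.inl u ∧ b = Sum.inr j ∧ j.val = 0) ∨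
    (∃ i j : Fin m, a = Sum.inr i ∧ b = Sum.inr j ∧ j.val = i.val + 1))

set_option linter.unusedSectionVars false
set_option linter.unusedVariables false
set_option linter.unusedSimpArgs false

section helpers
variable {V : Type*} [Fintype V] [DecidableEq V] (G : SimpleGraph V) [DecidableRel G.Adj]

def PathIn (S : Finset V) (l : List V) : Prop :=
  l.Nodup ∧ l.IsChain G.Adj ∧ ∀ x ∈ l, x ∈ S

def HasP (S : Finset V) (k : ℕ) : Prop := ∃ l, PathIn G S l ∧ l.length = k

/-- path starting at `v` with `k` further vertices -/
def HasPF (S : Finset V) (v : V) (k : ℕ) : Prop := ∃ l, PathIn G S (v :: l) ∧ l.length = k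

def dIn (S : Finset V) (a : V) : ℕ := (S.filter (G.Adj a)).card

def CC (S : Finset V) : Prop :=
  S.Nonempty ∧ ∀ A ⊆ S, A.Nonempty → A ≠ S → ∃ a ∈ A, ∃ b ∈ S, b ∉ A ∧ G.Adj a b

def Spin (A : Finset V) : Prop :=
  ∀ c ∈ A, ∃ l, PathIn G A (c :: l) ∧ l.length + 1 = A.card

variable {G}

theorem PathIn.mono {S T : Finset V} {l : List V} (h : PathIn G S l) (hST : S ⊆ T) : PathIn G T l :=
  ⟨h.1, h.2.1, fun x hx => hST (h.2.2 x hx)⟩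

theorem PathIn.sub {S T : Finset V} {l : List V} (h : PathIn G S l) (hT : ∀ x ∈ l, x ∈ T) : PathIn G T l :=
  ⟨h.1, h.2.1, hT⟩

theorem HasP.mono {S T : Finset V} {k : ℕ} (h : HasP G S k) (hST : S ⊆ T) : HasP G T k := by
  obtain ⟨l, hl, hk⟩ := h
  exact ⟨l, hl.mono hST, hk⟩

theorem PathIn.reverse {S : Finset V} {l : List V} (h : PathIn G S l) : PathIn G S l.reverse := by
  refine ⟨List.nodup_reverse.2 h.1, ?_, by simpa using h.2.2⟩
  rw [List.isChain_reverse]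
  exact h.2.1.imp (fun a b hab => hab.symm)

theorem PathIn.take {S : Finset V} {l : List V} (h : PathIn G S l) (n : ℕ) : PathIn G S (l.take n) :=
  ⟨h.1.sublist (List.take_sublist _ _), h.2.1.take n, fun x hx => h.2.2 x (List.mem_of_mem_take hx)⟩

theorem PathIn.drop {S : Finset V} {l : List V} (h : PathIn G S l) (n : ℕ) : PathIn G S (l.drop n) :=
  ⟨h.1.sublist (List.drop_sublist _ _), h.2.1.drop n, fun x hx => h.2.2 x (List.mem_of_mem_drop hx)⟩

theorem HasP.le {S : Finset V} {k j : ℕ} (h : HasP G S k) (hj : j ≤ k) : HasP G S j := by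
  obtain ⟨l, hl, hk⟩ := h
  exact ⟨l.take j, hl.take j, by simp; omega⟩

theorem HasPF.le {S : Finset V} {v : V} {k j : ℕ} (h : HasPF G S v k) (hj : j ≤ k) : HasPF G S v j := by
  obtain ⟨l, hl, hk⟩ := h
  exact ⟨l.take j, by simpa using hl.take (j+1), by simp; omega⟩

theorem PathIn.append {S : Finset V} {l m : List V} (h : PathIn G S l) (h' : PathIn G S m)
    (hd : ∀ x ∈ l, x ∉ m) (hj : ∀ x ∈ l.getLast?, ∀ y ∈ m.head?, G.Adj x y) : PathIn G S (l ++ m) := by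
  refine ⟨?_, ?_, ?_⟩
  · rw [List.nodup_append]
    exact ⟨h.1, h'.1, fun a ha b hb hab => hd a ha (hab ▸ hb)⟩
  · rw [List.isChain_append]
    exact ⟨h.2.1, h'.2.1, hj⟩
  · intro x hx
    rcases List.mem_append.1 hx with hx | hx
    · exact h.2.2 x hx
    · exact h'.2.2 x hx

theorem PathIn.cons {S : Finset V} {a b : V} {l : List V} (h : PathIn G S (b :: l))
    (ha : a ∈ S) (hal : a ∉ b :: l) (hab : G.Adj a b) : PathIn G S (a :: b :: l) := by
  refine ⟨List.nodup_cons.2 ⟨hal, h.1⟩, List.isChain_cons_cons.2 ⟨hab, h.2.1⟩, ?_⟩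
  intro x hx
  rcases List.mem_cons.1 hx with rfl | hx
  · exact ha
  · exact h.2.2 x hx

theorem PathIn.left {S : Finset V} {l m : List V} (h : PathIn G S (l ++ m)) : PathIn G S l := by
  have := h.take l.length
  simpa using this

theorem PathIn.right {S : Finset V} {l m : List V} (h : PathIn G S (l ++ m)) : PathIn G S m := by
  have := h.drop l.length
  simpa using this

theorem PathIn.card {S : Finset V} {l : List V} (h : PathIn G S l) : l.length ≤ S.card := by
  rw [← List.toFinset_card_of_nodup h.1]
  exact Finset.card_le_card (fun x hx => h.2.2 x (List.mem_toFinset.1 hx))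

theorem exists_max {P : ℕ → Prop} (n N : ℕ) (h0 : P n) (hN : ∀ k, P k → k ≤ N) :
    ∃ k, n ≤ k ∧ P k ∧ ¬ P (k+1) := by
  by_contra hcon
  push Not at hcon
  have : ∀ j, P (n + j) := by
    intro j
    induction j with
    | zero => exact h0
    | succ j ih => exact hcon (n+j) (by omega) ih
  have := hN _ (this (N+1))
  omega

theorem exists_maxP {S : Finset V} : ∃ k, HasP G S k ∧ ¬ HasP G S (k+1) := by
  obtain ⟨k, -, hk⟩ := exists_max (P := fun k => HasP G S k) 0 S.card ⟨[], ⟨by simp, by simp, by simp⟩, rfl⟩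
    (by rintro k ⟨l, hl, rfl⟩; exact hl.card)
  exact ⟨k, hk⟩

/-- cyclic list gives spin -/
theorem spin_of_cyc {S : Finset V} {l : List V} (h : PathIn G S l)
    (hc : ∀ x ∈ l.getLast?, ∀ y ∈ l.head?, G.Adj x y) : Spin G l.toFinset := by
  intro c hc'
  rw [List.mem_toFinset] at hc'
  obtain ⟨l1, l2, rfl⟩ := List.append_of_mem hc'
  refine ⟨l2 ++ l1, ?_, ?_⟩
  · have h1 := h.left
    have h2 := h.right
    have : PathIn G S ((c :: l2) ++ l1) := by
      apply h2.append h1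
      · intro x hx hx'
        have := h.1
        rw [List.nodup_append] at this
        exact this.2.2 x hx' x hx rfl
      · intro x hx y hy
        apply hc x _ y
        · simp [List.head?_append, Option.mem_def.1 hy]
        · rw [List.getLast?_append]
          simp [Option.mem_def.1 hx]
    refine this.sub ?_
    intro x hx
    simp at hx ⊢
    tauto
  · rw [List.toFinset_card_of_nodup h.1]
    simp; omega

/-- Crossing lemma. -/
theorem spin_of_deg {S : Finset V} {l : List V} (h : PathIn G S l) {a b : V}
    (ha : l.head? = some a) (hb : l.getLast? = some b)
    (hNa : ∀ x ∈ S, G.Adj a x → x ∈ l) (hNb : ∀ x ∈ S, G.Adj b x → x ∈ l)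
    (hd : l.length ≤ dIn G S a + dIn G S b) : Spin G l.toFinset := by
  have hpos : 0 < l.length := by
    cases l with
    | nil => simp at ha
    | cons c l => simp
  have ha' : l[0] = a := by
    rw [List.head?_eq_getElem?, List.getElem?_eq_getElem hpos] at ha
    simpa using ha
  have hb' : l[l.length - 1] = b := by
    rw [List.getLast?_eq_getElem?, List.getElem?_eq_getElem (by omega)] at hb
    simpa using hb
  let p : ℕ → V := fun i => l.getD i a
  have hp : ∀ i (hi : i < l.length), p i = l[i] := by
    intro i hi
    simp [p, hi]
  let N0 := (Finset.range (l.length - 1)).filter (fun i => G.Adj a (p (i+1)))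
  let N1 := (Finset.range (l.length - 1)).filter (fun i => G.Adj b (p i))
  have c0 : dIn G S a ≤ N0.card := by
    refine le_trans (Finset.card_le_card (t := N0.image (fun i => p (i+1))) ?_) Finset.card_image_le
    intro x hx
    rw [Finset.mem_filter] at hx
    obtain ⟨i, hi, rfl⟩ := List.getElem_of_mem (hNa x hx.1 hx.2)
    rw [Finset.mem_image]
    have : i ≠ 0 := by
      rintro rfl
      rw [ha'] at hx
      exact G.irrefl hx.2
    refine ⟨i - 1, ?_, ?_⟩
    · simp only [N0, Finset.mem_filter, Finset.mem_range]
      rw [show i - 1 + 1 = i by omega, hp i hi]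
      exact ⟨by omega, hx.2⟩
    · rw [show i - 1 + 1 = i by omega, hp i hi]
  have c1 : dIn G S b ≤ N1.card := by
    refine le_trans (Finset.card_le_card (t := N1.image (fun i => p i)) ?_) Finset.card_image_le
    intro x hx
    rw [Finset.mem_filter] at hx
    obtain ⟨i, hi, rfl⟩ := List.getElem_of_mem (hNb x hx.1 hx.2)
    rw [Finset.mem_image]
    have : i ≠ l.length - 1 := by
      rintro rfl
      rw [hb'] at hx
      exact G.irrefl hx.2
    refine ⟨i, ?_, ?_⟩
    · simp only [N1, Finset.mem_filter, Finset.mem_range]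
      rw [hp i hi]
      exact ⟨by omega, hx.2⟩
    · rw [hp i hi]
  have : ∃ i ∈ N0, i ∈ N1 := by
    by_contra hcon
    push Not at hcon
    have hdis : Disjoint N0 N1 := Finset.disjoint_left.2 hcon
    have h1 := Finset.card_union_of_disjoint hdis
    have h2 : (N0 ∪ N1).card ≤ (Finset.range (l.length - 1)).card :=
      Finset.card_le_card (Finset.union_subset (Finset.filter_subset _ _) (Finset.filter_subset _ _))
    rw [Finset.card_range] at h2
    omega
  obtain ⟨i, hi0, hi1⟩ := this
  simp only [N0, N1, Finset.mem_filter, Finset.mem_range] at hi0 hi1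
  have hil : i + 1 < l.length := by omega
  rw [hp _ hil] at hi0
  rw [hp _ (by omega)] at hi1
  have key : PathIn G S (l.take (i+1) ++ (l.drop (i+1)).reverse) := by
    apply (h.take _).append (h.drop _).reverse
    · intro x hx hx'
      rw [List.mem_reverse] at hx'
      have := h.1
      rw [← List.take_append_drop (i+1) l, List.nodup_append] at this
      exact this.2.2 x hx x hx' rfl
    · intro x hx y hy
      have e1 : (l.take (i+1)).getLast? = some l[i] := by
        rw [List.getLast?_take]; simp
      have e2 : (l.drop (i+1)).reverse.head? = some b := by
        rw [List.head?_reverse, List.getLast?_drop, if_neg (by omega), hb]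
      rw [e1] at hx; rw [e2] at hy
      simp at hx hy
      subst hx; subst hy
      exact hi1.2.symm
  have := spin_of_cyc key (by
    intro x hx y hy
    have e1 : (l.take (i+1) ++ (l.drop (i+1)).reverse).head? = some a := by
      rw [List.head?_append, List.head?_take, if_neg (by omega), ha]; rfl
    have e2 : (l.take (i+1) ++ (l.drop (i+1)).reverse).getLast? = some l[i+1] := by
      rw [List.getLast?_append]; simp [List.head?_drop, hil]
    rw [e1] at hy; rw [e2] at hx
    simp at hx hy
    subst hx; subst hy
    exact hi0.2.symm)
  convert this using 1
  ext x
  simp only [List.mem_toFinset, List.mem_append, List.mem_reverse]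
  rw [← List.mem_append, List.take_append_drop]

theorem spin_grow {S A : Finset V} (hS : CC G S) (hA : Spin G A) (hAS : A ⊆ S) (hne : A.Nonempty) (hneq : A ≠ S) :
    HasP G S (A.card + 1) := by
  obtain ⟨a, ha, b, hb, hbA, hab⟩ := hS.2 A hAS hne hneq
  obtain ⟨l, hl, hc⟩ := hA a ha
  refine ⟨b :: a :: l, (hl.mono hAS).cons hb ?_ hab.symm, by simp [hc]⟩
  intro hb'
  exact hbA (hl.2.2 b hb')

theorem max_end {S : Finset V} {l : List V} (h : PathIn G S l) (hmax : ¬ HasP G S (l.length + 1)) {a : V}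
    (ha : l.head? = some a) : ∀ x ∈ S, G.Adj a x → x ∈ l := by
  intro x hx hax
  by_contra hxl
  apply hmax
  cases l with
  | nil => simp at ha
  | cons c l =>
    simp at ha; subst ha
    exact ⟨x :: c :: l, h.cons hx hxl hax.symm, by simp⟩

theorem max_end' {S : Finset V} {l : List V} (h : PathIn G S l) (hmax : ¬ HasP G S (l.length + 1)) {a : V}
    (ha : l.getLast? = some a) : ∀ x ∈ S, G.Adj a x → x ∈ l := by
  have := max_end h.reverse (by simpa using hmax) (a := a) (by simpa using ha)
  simpa using this

/-- degree sum of the ends of a longest path which is not spanning -/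
theorem max_degsum {S : Finset V} {l : List V} (hS : CC G S) (h : PathIn G S l) (hmax : ¬ HasP G S (l.length + 1))
    (hlt : l.length < S.card) {a b : V} (ha : l.head? = some a) (hb : l.getLast? = some b) :
    dIn G S a + dIn G S b < l.length := by
  by_contra hcon
  have hsp := spin_of_deg h ha hb (max_end h hmax ha) (max_end' h hmax hb) (by omega)
  have hc := List.toFinset_card_of_nodup h.1
  have := spin_grow hS hsp (fun x hx => h.2.2 x (List.mem_toFinset.1 hx)) ⟨a, by
    rw [List.mem_toFinset]; exact List.mem_of_mem_head? ha⟩ (by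
    intro he; rw [he] at hc; omega)
  rw [hc] at this
  exact hmax this

theorem ends {l : List V} (h : l ≠ []) : ∃ a b, l.head? = some a ∧ l.getLast? = some b :=
  ⟨l.head h, l.getLast h, List.head?_eq_some_head h, List.getLast?_eq_some_getLast h⟩

theorem maxP_pos {S : Finset V} (hS : S.Nonempty) {k : ℕ} (hk : ¬ HasP G S (k+1)) : 0 < k := by
  rcases Nat.eq_zero_or_pos k with rfl | h
  · obtain ⟨x, hx⟩ := hS
    exact absurd ⟨[x], ⟨by simp, by simp, by simpa using hx⟩, rfl⟩ hk
  · exact h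

theorem dirac {S : Finset V} (hS : CC G S) {d : ℕ} (hd : ∀ a ∈ S, d ≤ dIn G S a) :
    HasP G S S.card ∨ HasP G S (2 * d + 1) := by
  obtain ⟨k, ⟨l, hl, rfl⟩, hmax⟩ := exists_maxP (G := G) (S := S)
  have hpos := maxP_pos hS.1 hmax
  by_cases hlt : l.length < S.card
  · right
    obtain ⟨a, b, ha, hb⟩ := ends (l := l) (by rintro rfl; simp at hpos)
    have h1 := max_degsum hS hl hmax hlt ha hb
    have h2 := hd a (hl.2.2 a (List.mem_of_mem_head? ha))
    have h3 := hd b (hl.2.2 b (List.mem_of_getLast? hb))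
    exact HasP.le ⟨l, hl, rfl⟩ (by omega)
  · left
    exact HasP.le ⟨l, hl, rfl⟩ (by omega)

end helpers
section helpers2
variable {V : Type*} [Fintype V] [DecidableEq V] {G : SimpleGraph V} [DecidableRel G.Adj]

theorem last_mem_tail {v w : V} {l : List V} (hw : (v :: l).getLast? = some w) (hne : l ≠ []) : w ∈ l := by
  rw [List.getLast?_cons_of_ne_nil hne] at hw
  exact List.mem_of_getLast? hw

/-- a branch at `v` -/
structure Br (G : SimpleGraph V) (v : V) (C : Finset V) : Prop where
  cc : CC G C
  nv : v ∉ C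
  nb : ∃ a ∈ C, G.Adj v a
  cl : ∀ a ∈ C, ∀ b, G.Adj a b → b = v ∨ b ∈ C

theorem dIn_le {S : Finset V} {A : Finset V} {a : V} (h : ∀ x ∈ S, G.Adj a x → x ∈ A) : dIn G S a ≤ A.card := by
  apply Finset.card_le_card
  intro x hx
  rw [Finset.mem_filter] at hx
  exact h x hx.1 hx.2

theorem dIn_of_deg {h : ℕ} (hδ : ∀ v, h ≤ G.degree v) {S : Finset V} {a : V}
    (hS : ∀ b, G.Adj a b → b ∈ S) : h ≤ dIn G S a := by
  refine (hδ a).trans (Finset.card_le_card ?_)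
  intro x hx
  rw [mem_neighborFinset] at hx
  exact Finset.mem_filter.2 ⟨hS x hx, hx⟩

theorem dIn_erase {S : Finset V} {a v : V} : dIn G S a ≤ dIn G (S.erase v) a + 1 := by
  unfold dIn
  have : S.filter (G.Adj a) ⊆ insert v ((S.erase v).filter (G.Adj a)) := by
    intro x hx
    rw [Finset.mem_filter] at hx
    by_cases hxv : x = v
    · simp [hxv]
    · simp [hxv, hx]
  exact (Finset.card_le_card this).trans (Finset.card_insert_le _ _)

theorem Br.deg {h : ℕ} (hδ : ∀ v, h ≤ G.degree v) {v : V} {C : Finset V} (hB : Br G v C) {a : V} (ha : a ∈ C) :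
    h ≤ dIn G (insert v C) a :=
  dIn_of_deg hδ (fun b hb => by rcases hB.cl a ha b hb with h | h <;> simp [h])

theorem Br.deg' {h : ℕ} (hδ : ∀ v, h ≤ G.degree v) {v : V} {C : Finset V} (hB : Br G v C) {a : V} (ha : a ∈ C) :
    h - 1 ≤ dIn G C a := by
  have h1 := hB.deg hδ ha
  have h2 := dIn_erase (G := G) (S := insert v C) (a := a) (v := v)
  rw [Finset.erase_insert hB.nv] at h2
  omega

theorem Br.card_ge {h : ℕ} (hδ : ∀ v, h ≤ G.degree v) {v : V} {C : Finset V} (hB : Br G v C) : h ≤ C.card := by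
  obtain ⟨a, ha⟩ := hB.cc.1
  have h1 := hB.deg hδ ha
  have h2 : dIn G (insert v C) a ≤ ((insert v C).erase a).card := dIn_le (fun x hx hax => by
    rw [Finset.mem_erase]; exact ⟨hax.ne', hx⟩)
  rw [Finset.card_erase_of_mem (by simp [ha]), Finset.card_insert_of_notMem hB.nv] at h2
  omega

theorem Br.ccv {v : V} {C : Finset V} (hB : Br G v C) : CC G (insert v C) := by
  refine ⟨by simp, fun A hA hne hneq => ?_⟩
  obtain ⟨y, hy, hvy⟩ := hB.nb
  by_cases hCA : C ⊆ A
  · have hvA : v ∉ A := by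
      intro hvA
      exact hneq (Finset.Subset.antisymm hA (Finset.insert_subset hvA hCA))
    exact ⟨y, hCA hy, v, by simp, hvA, hvy.symm⟩
  · by_cases h0 : (A ∩ C).Nonempty
    · obtain ⟨a, ha, b, hb, hb', hab⟩ := hB.cc.2 (A ∩ C) Finset.inter_subset_right h0 (by
        intro he; exact hCA (by rw [← he]; exact Finset.inter_subset_left))
      refine ⟨a, (Finset.mem_inter.1 ha).1, b, by simp [hb], ?_, hab⟩
      intro hbA; exact hb' (Finset.mem_inter.2 ⟨hbA, hb⟩)
    · have hdis : ∀ x ∈ A, x = v := by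
        intro x hx
        rcases Finset.mem_insert.1 (hA hx) with h | h
        · exact h
        · exact absurd ⟨x, Finset.mem_inter.2 ⟨hx, h⟩⟩ h0
      obtain ⟨x, hx⟩ := hne
      have := hdis x hx
      subst this
      refine ⟨x, hx, y, by simp [hy], ?_, hvy⟩
      intro hyA
      have := hdis y hyA
      subst this
      exact hB.nv hy

theorem HasPF.max_exists {S : Finset V} {v : V} (n : ℕ) (h : HasPF G S v n) :
    ∃ k, n ≤ k ∧ HasPF G S v k ∧ ¬ HasPF G S v (k+1) :=
  exists_max n S.card h (by
    rintro k ⟨l, hl, rfl⟩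
    have := hl.card
    simp at this
    omega)

theorem HasPF.toP {S : Finset V} {v : V} {k : ℕ} (h : HasPF G S v k) : HasP G S (k+1) := by
  obtain ⟨l, hl, rfl⟩ := h
  exact ⟨v :: l, hl, by simp⟩

theorem HasPF.tail {C : Finset V} {v : V} {k : ℕ} (h : HasPF G (insert v C) v k) : HasP G C k := by
  obtain ⟨l, hl, rfl⟩ := h
  have := hl.drop 1
  simp at this
  refine ⟨l, this.sub ?_, rfl⟩
  intro x hx
  have h1 := this.2.2 x hx
  have h2 := (List.nodup_cons.1 hl.1).1
  rcases Finset.mem_insert.1 h1 with h | h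
  · subst h; exact absurd hx h2
  · exact h

theorem pf_end {S : Finset V} {v w : V} {l : List V} (h : PathIn G S (v :: l))
    (hmax : ¬ HasPF G S v (l.length + 1)) (hw : (v :: l).getLast? = some w) :
    ∀ x ∈ S, G.Adj w x → x ∈ v :: l := by
  intro x hx hwx
  by_contra hxl
  apply hmax
  refine ⟨l ++ [x], ?_, by simp⟩
  have : PathIn G S ((v :: l) ++ [x]) := by
    apply h.append ⟨by simp, by simp, by simpa using hx⟩
    · intro y hy hy'
      simp at hy'; subst hy'; exact hxl hy
    · intro y hy z hz
      rw [hw] at hy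
      simp at hy hz
      subst hy; subst hz; exact hwx
  simpa using this

/-- long path from the cut vertex, or the branch is a clique -/
theorem branch_path {h : ℕ} (hh : 1 ≤ h) (hδ : ∀ v, h ≤ G.degree v) {v : V} {C : Finset V} (hB : Br G v C) :
    HasPF G (insert v C) v h ∧ (HasPF G (insert v C) v (h+1) ∨
      (C.card = h ∧ ∀ a ∈ insert v C, ∀ b ∈ insert v C, a ≠ b → G.Adj a b)) := by
  obtain ⟨y, hy, hvy⟩ := hB.nb
  have hvn : v ∉ C := hB.nv
  obtain ⟨k, hk1, ⟨l, hl, rfl⟩, hmax⟩ := HasPF.max_exists (G := G) (S := insert v C) (v := v) 1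
    ⟨[y], ⟨by simp; rintro rfl; exact hvn hy, by simpa using hvy, by simp [hy]⟩, rfl⟩
  -- a general fact on maximal paths from v
  have gen : ∀ m : List V, PathIn G (insert v C) (v :: m) → m.length = l.length → ∀ w,
      (v :: m).getLast? = some w → h ≤ dIn G (insert v C) w ∧
        (insert v C).filter (G.Adj w) ⊆ (v :: m).toFinset.erase w := by
    intro m hm hml w hw
    have hmn : m ≠ [] := by rintro rfl; simp at hml; omega
    have hwm := last_mem_tail hw hmn
    have hwC : w ∈ C := by
      rcases Finset.mem_insert.1 (hm.2.2 w (by simp [hwm])) with h | h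
      · subst h; exact absurd hwm (List.nodup_cons.1 hm.1).1
      · exact h
    refine ⟨hB.deg hδ hwC, ?_⟩
    intro x hx
    rw [Finset.mem_filter] at hx
    rw [Finset.mem_erase, List.mem_toFinset]
    exact ⟨hx.2.ne', pf_end hm (by rw [hml]; exact hmax) hw x hx.1 hx.2⟩
  have hcard : ∀ m : List V, PathIn G (insert v C) (v :: m) → ∀ w, (v :: m).getLast? = some w →
      ((v :: m).toFinset.erase w).card = m.length := by
    intro m hm w hw
    rw [Finset.card_erase_of_mem (by rw [List.mem_toFinset]; exact List.mem_of_getLast? hw),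
      List.toFinset_card_of_nodup hm.1]
    simp
  have hge : h ≤ l.length := by
    obtain ⟨a, b, -, hb⟩ := ends (l := v :: l) (by simp)
    obtain ⟨g1, g2⟩ := gen l hl rfl b hb
    have := Finset.card_le_card g2
    rw [hcard l hl b hb] at this
    exact g1.trans this
  refine ⟨HasPF.le ⟨l, hl, rfl⟩ hge, ?_⟩
  by_cases hlt : h + 1 ≤ l.length
  · left; exact HasPF.le ⟨l, hl, rfl⟩ hlt
  right
  have hlen : l.length = h := by omega
  -- ends of max paths
  have gen2 : ∀ m : List V, PathIn G (insert v C) (v :: m) → m.length = l.length → ∀ w,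
      (v :: m).getLast? = some w →
        (insert v C).filter (G.Adj w) = (v :: m).toFinset.erase w := by
    intro m hm hml w hw
    obtain ⟨g1, g2⟩ := gen m hm hml w hw
    exact Finset.eq_of_subset_of_card_le g2 (by rw [hcard m hm w hw]; unfold dIn at g1; omega)
  obtain ⟨_, w, -, hw⟩ := ends (l := v :: l) (by simp)
  have hwadj := gen2 l hl rfl w hw
  have allz : ∀ z ∈ l, (insert v C).filter (G.Adj z) = (v :: l).toFinset.erase z := by
    intro z hz
    obtain ⟨l1, l2, rfl⟩ := List.append_of_mem hz
    by_cases hl2 : l2 = []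
    · subst hl2
      have : w = z := by
        rw [← List.cons_append, List.getLast?_append] at hw
        simpa using hw.symm
      subst this; exact hwadj
    have hl' : PathIn G (insert v C) ((v :: l1) ++ (z :: l2)) := by simpa using hl
    have hnd := hl'.1
    rw [List.nodup_append] at hnd
    have hw2 : (z :: l2).getLast? = some w := by
      rw [← List.cons_append, List.getLast?_append] at hw
      simpa using hw
    have hwmem : w ∈ z :: l2 := List.mem_of_getLast? hw2
    have hP : PathIn G (insert v C) ((v :: l1) ++ (z :: l2).reverse) := by
      apply hl'.left.append hl'.right.reverse
      · intro x hx hx'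
        rw [List.mem_reverse] at hx'
        exact hnd.2.2 x hx x hx' rfl
      · intro a ha b hb
        rw [List.head?_reverse, hw2] at hb
        simp only [Option.mem_def, Option.some.injEq] at hb
        subst hb
        have ha' := List.mem_of_getLast? ha
        have : a ∈ (insert v C).filter (G.Adj w) := by
          rw [hwadj, Finset.mem_erase, List.mem_toFinset]
          refine ⟨hnd.2.2 a ha' w hwmem, ?_⟩
          rw [← List.cons_append]; exact List.mem_append_left _ ha'
        exact (Finset.mem_filter.1 this).2.symm
    have := gen2 (l1 ++ (z :: l2).reverse) (by simpa using hP) (by simp) z (by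
      rw [← List.cons_append, List.getLast?_append]; simp)
    rw [this]
    congr 1
    ext x
    simp
  have hlC : l.toFinset ⊆ C := by
    intro x hx
    rw [List.mem_toFinset] at hx
    rcases Finset.mem_insert.1 (hl.2.2 x (by simp [hx])) with h | h
    · subst h; exact absurd hx (List.nodup_cons.1 hl.1).1
    · exact h
  have hnd := (List.nodup_cons.1 hl.1)
  have heq : l.toFinset = C := by
    by_contra hne
    obtain ⟨a, ha, b, hb, hb', hab⟩ := hB.cc.2 l.toFinset hlC (by
      rw [List.toFinset_nonempty_iff]; rintro rfl; simp at hlen; omega) hne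
    rw [List.mem_toFinset] at ha hb'
    have : b ∈ (insert v C).filter (G.Adj a) := by simp [hb, hab]
    rw [allz a ha, Finset.mem_erase, List.mem_toFinset, List.mem_cons] at this
    rcases this.2 with h | h
    · subst h; exact hvn hb
    · exact hb' h
  refine ⟨by rw [← heq, List.toFinset_card_of_nodup hnd.2, hlen], ?_⟩
  have key : ∀ a ∈ C, ∀ b ∈ insert v C, a ≠ b → G.Adj a b := by
    intro a ha b hb hab
    rw [← heq, List.mem_toFinset] at ha
    have : b ∈ (v :: l).toFinset.erase a := by
      rw [Finset.mem_erase, List.toFinset_cons, heq]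
      exact ⟨hab.symm, hb⟩
    rw [← allz a ha] at this
    exact (Finset.mem_filter.1 this).2
  intro a ha b hb hab
  rcases Finset.mem_insert.1 ha with rfl | ha'
  · rcases Finset.mem_insert.1 hb with rfl | hb'
    · exact absurd rfl hab
    · exact (key b hb' a ha hab.symm).symm
  · exact key a ha' b hb hab

/-- Lemma X -/
theorem lemX {h : ℕ} (hh : 2 ≤ h) (hδ : ∀ v, h ≤ G.degree v) {v : V} {C : Finset V} (hB : Br G v C) :
    HasPF G (insert v C) v C.card ∨ HasP G (insert v C) (2 * h + 1) := by
  have hvn : v ∉ C := hB.nv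
  have hcc := hB.ccv
  have hcv : (insert v C).card = C.card + 1 := Finset.card_insert_of_notMem hvn
  obtain ⟨k, hk, hmax⟩ := exists_maxP (G := G) (S := insert v C)
  -- paths with spinning and length k
  have spin_done : ∀ l : List V, PathIn G (insert v C) l → l.length = k → l ≠ [] → Spin G l.toFinset →
      HasPF G (insert v C) v C.card := by
    intro l hl hlk hne hsp
    have hsub : l.toFinset ⊆ insert v C := fun x hx => hl.2.2 x (List.mem_toFinset.1 hx)
    have hc := List.toFinset_card_of_nodup hl.1
    by_cases heq : l.toFinset = insert v C
    · obtain ⟨m, hm, hmc⟩ := hsp v (by rw [heq]; simp)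
      refine ⟨m, hm.mono hsub, ?_⟩
      rw [heq] at hmc; omega
    · have := spin_grow hcc hsp hsub (by simpa [List.toFinset_nonempty_iff] using hne) heq
      rw [hc, hlk] at this
      exact absurd this hmax
  by_cases hA : ∃ l a b, PathIn G (insert v C) l ∧ l.length = k ∧ l.head? = some a ∧ l.getLast? = some b ∧ a ≠ v ∧ b ≠ v
  · obtain ⟨l, a, b, hl, hlk, ha, hb, hav, hbv⟩ := hA
    have haC : a ∈ C := (Finset.mem_insert.1 (hl.2.2 a (List.mem_of_mem_head? ha))).resolve_left hav
    have hbC : b ∈ C := (Finset.mem_insert.1 (hl.2.2 b (List.mem_of_getLast? hb))).resolve_left hbv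
    have h1 := hB.deg hδ haC
    have h2 := hB.deg hδ hbC
    by_cases hkk : 2 * h + 1 ≤ k
    · right; exact hk.le hkk
    · left
      apply spin_done l hl hlk (by rintro rfl; simp at ha)
      exact spin_of_deg hl ha hb (max_end hl (by rw [hlk]; exact hmax) ha)
        (max_end' hl (by rw [hlk]; exact hmax) hb) (by omega)
  -- all longest paths end at v
  have hl0 : ∃ l, PathIn G (insert v C) (v :: l) ∧ (v :: l).length = k := by
    obtain ⟨l, hl, hlk⟩ := hk
    have hpos := maxP_pos (G := G) (S := insert v C) (by simp) hmax
    obtain ⟨a, b, ha, hb⟩ := ends (l := l) (by rintro rfl; simp at hlk; omega)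
    by_cases hav : a = v
    · subst hav
      cases l with
      | nil => simp at ha
      | cons c l => simp at ha; subst ha; exact ⟨l, hl, hlk⟩
    · have hbv : b = v := by
        by_contra hbv
        exact hA ⟨l, a, b, hl, hlk, ha, hb, hav, hbv⟩
      subst hbv
      have hr := hl.reverse
      have hr1 : l.reverse.head? = some b := by simpa using hb
      have hr2 : l.reverse.length = k := by simpa using hlk
      cases hlr : l.reverse with
      | nil => rw [hlr] at hr1; simp at hr1
      | cons c m => rw [hlr] at hr hr1 hr2; simp at hr1; subst hr1; exact ⟨m, hr, hr2⟩
  obtain ⟨l, hl, hlk⟩ := hl0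
  by_cases hkk : 2 * h + 1 ≤ k
  · right; exact hk.le hkk
  have hk2 : 2 ≤ k := by
    by_contra hcon
    obtain ⟨y, hy, hvy⟩ := hB.nb
    have : HasP G (insert v C) 2 := ⟨[v, y], ⟨by simp; rintro rfl; exact hvn hy, by simpa using hvy, by simp [hy]⟩, rfl⟩
    have hpos := maxP_pos (G := G) (S := insert v C) (by simp) hmax
    exact hmax (this.le (by omega))
  cases l with
  | nil => simp at hlk; omega
  | cons p l =>
    have hmax' : ¬ HasP G (insert v C) ((v :: p :: l).length + 1) := by rw [hlk]; exact hmax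
    obtain ⟨_, w, -, hw⟩ := ends (l := v :: p :: l) (by simp)
    have hw' : (p :: l).getLast? = some w := by simpa using hw
    have hnd := (List.nodup_cons.1 hl.1)
    have hmem : ∀ x ∈ p :: l, x ∈ C := by
      intro x hx
      rcases Finset.mem_insert.1 (hl.2.2 x (List.mem_cons_of_mem _ hx)) with h | h
      · subst h; exact absurd hx hnd.1
      · exact h
    have hpC : p ∈ C := hmem p (by simp)
    have hwm : w ∈ p :: l := List.mem_of_getLast? hw'
    have hwC : w ∈ C := hmem w hwm
    have hwv : w ≠ v := by rintro rfl; exact hvn hwC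
    by_cases hadj : G.Adj w v
    · left
      refine spin_done _ hl hlk (by simp) (spin_of_cyc hl ?_)
      intro x hx y hy
      rw [hw] at hx
      simp at hx hy
      subst hx; subst hy; exact hadj
    have hl' : PathIn G C (p :: l) := ⟨hnd.2, (List.isChain_cons_cons.1 hl.2.1).2, hmem⟩
    have hNp : ∀ x ∈ C, G.Adj p x → x ∈ p :: l := by
      intro x hx hpx
      by_contra hxl
      apply hA
      refine ⟨x :: p :: l, x, w, (hl'.cons hx hxl hpx.symm).mono (Finset.subset_insert _ _), by simpa using hlk, by simp, by simpa using hw', ?_, hwv⟩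
      rintro rfl; exact hvn hx
    have hNw : ∀ x ∈ C, G.Adj w x → x ∈ p :: l := by
      intro x hx hwx
      have := max_end' hl hmax' hw x (by simp [hx]) hwx
      rcases List.mem_cons.1 this with h | h
      · subst h; exact absurd hx hvn
      · exact h
    have dp : h - 1 ≤ dIn G C p := hB.deg' hδ hpC
    have dw : h ≤ dIn G C w := by
      apply dIn_of_deg hδ
      intro b hb
      rcases hB.cl w hwC b hb with h | h
      · subst h; exact absurd hb hadj
      · exact h
    have hlen : (p :: l).length + 1 = k := by simpa using hlk
    have hsp := spin_of_deg hl' (by simp) hw' hNp hNw (by omega)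
    have hc := List.toFinset_card_of_nodup hnd.2
    have hsub : (p :: l).toFinset ⊆ C := fun x hx => hmem x (List.mem_toFinset.1 hx)
    by_cases heq : (p :: l).toFinset = C
    · left
      exact ⟨p :: l, hl, by rw [← heq, hc]⟩
    · exfalso
      obtain ⟨a, ha, b, hb, hbA, hab⟩ := hB.cc.2 _ hsub ⟨p, by simp⟩ heq
      obtain ⟨m, hm, hmc⟩ := hsp a ha
      have hmC := hm.mono hsub
      have hP := hmC.cons hb (fun hb' => hbA (hm.2.2 b hb')) hab.symm
      obtain ⟨_, e, -, he⟩ := ends (l := b :: a :: m) (by simp)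
      refine hA ⟨b :: a :: m, b, e, hP.mono (Finset.subset_insert _ _), ?_, by simp, he, ?_, ?_⟩
      · simp only [List.length_cons] at *
        omega
      · rintro rfl; exact hvn hb
      · rintro rfl; exact hvn (hP.2.2 _ (List.mem_of_getLast? he))

end helpers2
section helpers3
variable {V : Type*} [Fintype V] [DecidableEq V] {G : SimpleGraph V} [DecidableRel G.Adj]

open Classical in
noncomputable def comp (G : SimpleGraph V) (S : Finset V) (x : V) : Finset V :=
  S.filter (fun y => Relation.ReflTransGen (fun a b => G.Adj a b ∧ a ∈ S ∧ b ∈ S) x y)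

theorem comp_sub {S : Finset V} {x : V} : comp G S x ⊆ S := by
  classical
  unfold comp; exact Finset.filter_subset _ _

theorem mem_comp {S : Finset V} {x y : V} : y ∈ comp G S x ↔
    y ∈ S ∧ Relation.ReflTransGen (fun a b => G.Adj a b ∧ a ∈ S ∧ b ∈ S) x y := by
  classical
  unfold comp; rw [Finset.mem_filter]

theorem self_comp {S : Finset V} {x : V} (hx : x ∈ S) : x ∈ comp G S x :=
  mem_comp.2 ⟨hx, Relation.ReflTransGen.refl⟩

theorem comp_cl {S : Finset V} {x a b : V} (ha : a ∈ comp G S x) (hb : b ∈ S) (hab : G.Adj a b) :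
    b ∈ comp G S x := by
  rw [mem_comp] at ha ⊢
  exact ⟨hb, ha.2.tail ⟨hab, ha.1, hb⟩⟩

theorem comp_inv {S A : Finset V} {x y : V} (hcl : ∀ a ∈ S, ∀ b ∈ S, G.Adj a b → (a ∈ A ↔ b ∈ A))
    (h : Relation.ReflTransGen (fun a b => G.Adj a b ∧ a ∈ S ∧ b ∈ S) x y) : x ∈ A ↔ y ∈ A := by
  induction h with
  | refl => rfl
  | tail _ h ih => exact ih.trans (hcl _ h.2.1 _ h.2.2 h.1)

theorem comp_cc {S : Finset V} {x : V} (hx : x ∈ S) : CC G (comp G S x) := by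
  refine ⟨⟨x, self_comp hx⟩, fun A hA hne hneq => ?_⟩
  by_contra hcon
  push Not at hcon
  have hcl : ∀ a ∈ S, ∀ b ∈ S, G.Adj a b → (a ∈ A ↔ b ∈ A) := by
    intro a ha b hb hab
    constructor
    · intro haA
      by_contra hbA
      exact hcon a haA b (comp_cl (hA haA) hb hab) hbA hab
    · intro hbA
      by_contra haA
      exact hcon b hbA a (comp_cl (hA hbA) ha hab.symm) haA hab.symm
  obtain ⟨y, hy⟩ := hne
  have hxA : x ∈ A := (comp_inv hcl (mem_comp.1 (hA hy)).2).2 hy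
  apply hneq
  apply Finset.Subset.antisymm hA
  intro z hz
  exact (comp_inv hcl (mem_comp.1 hz).2).1 hxA

theorem comp_eq {S : Finset V} {x y : V} (hy : y ∈ comp G S x) : comp G S y = comp G S x := by
  have hsym : Relation.ReflTransGen (fun a b => G.Adj a b ∧ a ∈ S ∧ b ∈ S) y x := by
    haveI : Std.Symm (fun a b => G.Adj a b ∧ a ∈ S ∧ b ∈ S) := ⟨by
      rintro a b ⟨h1, h2, h3⟩
      exact ⟨h1.symm, h3, h2⟩⟩
    exact Relation.ReflTransGen.symmetric.symm _ _ (mem_comp.1 hy).2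
  ext z
  rw [mem_comp, mem_comp]
  constructor
  · rintro ⟨h1, h2⟩; exact ⟨h1, (mem_comp.1 hy).2.trans h2⟩
  · rintro ⟨h1, h2⟩; exact ⟨h1, hsym.trans h2⟩

theorem comp_disj {S : Finset V} {x y : V} (hne : comp G S x ≠ comp G S y) :
    Disjoint (comp G S x) (comp G S y) := by
  rw [Finset.disjoint_left]
  intro z hz hz'
  exact hne ((comp_eq hz).symm.trans (comp_eq hz'))

theorem cc_univ (hconn : G.Connected) : CC G Finset.univ := by
  obtain ⟨v⟩ := hconn.nonempty
  refine ⟨⟨v, by simp⟩, fun A _ hne hneq => ?_⟩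
  by_contra hcon
  push Not at hcon
  obtain ⟨y, hy⟩ := hne
  apply hneq
  ext z
  simp only [Finset.mem_univ, iff_true]
  obtain ⟨w⟩ := hconn.preconnected y z
  induction w with
  | nil => exact hy
  | cons hab _ ih =>
    apply ih
    by_contra hb
    exact hcon _ hy _ (by simp) hb hab

theorem Br_comp (hconn : G.Connected) {v x : V} (hx : x ≠ v) : Br G v (comp G (Finset.univ.erase v) x) := by
  have hxS : x ∈ Finset.univ.erase v := by simp [hx]
  have hv : v ∉ comp G (Finset.univ.erase v) x := by
    intro h
    have := comp_sub h
    simp at this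
  refine ⟨comp_cc hxS, hv, ?_, ?_⟩
  · obtain ⟨a, ha, b, -, hb, hab⟩ := (cc_univ hconn).2 (comp G (Finset.univ.erase v) x) (by simp) ⟨x, self_comp hxS⟩ (by
      intro he; rw [he] at hv; simp at hv)
    have : b = v := by
      by_contra hbv
      exact hb (comp_cl ha (by simp [hbv]) hab)
    subst this
    exact ⟨a, ha, hab.symm⟩
  · intro a ha b hab
    by_cases hbv : b = v
    · exact Or.inl hbv
    · exact Or.inr (comp_cl ha (by simp [hbv]) hab)

theorem two_comps {v : V} (hn : 2 ≤ Fintype.card V) (hcut : ¬ (G.induce {u | u ≠ v}).Connected) :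
    ∃ x y, x ≠ v ∧ y ≠ v ∧ comp G (Finset.univ.erase v) x ≠ comp G (Finset.univ.erase v) y := by
  by_contra hcon
  push Not at hcon
  apply hcut
  have hne : ∃ x : V, x ≠ v := by
    have : Nontrivial V := Fintype.one_lt_card_iff_nontrivial.1 (by omega)
    exact exists_ne v
  obtain ⟨x0, hx0⟩ := hne
  haveI : Nonempty ({u : V | u ≠ v} : Set V) := ⟨⟨x0, hx0⟩⟩
  refine ⟨?_⟩
  rintro ⟨x, hx⟩ ⟨y, hy⟩
  have hx' : x ≠ v := hx
  have hy' : y ≠ v := hy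
  have hmem : y ∈ comp G (Finset.univ.erase v) x := by
    rw [hcon x y hx' hy']
    exact self_comp (by simp [hy'])
  have h2 := (mem_comp.1 hmem).2
  have : ∃ hy : y ∈ {u : V | u ≠ v}, (G.induce {u | u ≠ v}).Reachable ⟨x, hx⟩ ⟨y, hy⟩ := by
    clear hmem hy hy'
    induction h2 with
    | refl => exact ⟨hx, Reachable.refl _⟩
    | tail _ h ih =>
      obtain ⟨hb, hr⟩ := ih
      have hc := h.2.2
      simp at hc
      refine ⟨hc, hr.trans (Adj.reachable ?_)⟩
      exact h.1
  exact this.2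

theorem CF {S T : Finset V} {a c : ℕ} (hST : Disjoint S T) (h1 : HasP G S a) (h2 : HasP G T c) :
    ContainsForest G ![a, c] := by
  obtain ⟨l, hl, rfl⟩ := h1
  obtain ⟨m, hm, rfl⟩ := h2
  have hd : ∀ x ∈ l, ∀ y ∈ m, x ≠ y := by
    rintro x hx y hy rfl
    exact Finset.disjoint_left.1 hST (hl.2.2 x hx) (hm.2.2 x hy)
  refine ⟨fun i => match i with
    | 0 => fun j => l.get j
    | 1 => fun j => m.get j, ?_, ?_, ?_⟩
  · intro i
    fin_cases i
    · exact List.nodup_iff_injective_get.1 hl.1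
    · exact List.nodup_iff_injective_get.1 hm.1
  · intro i j hij
    fin_cases i <;> fin_cases j
    · exact absurd rfl hij
    · intro a b; exact hd _ (List.get_mem l a) _ (List.get_mem m b)
    · intro a b; exact (hd _ (List.get_mem l b) _ (List.get_mem m a)).symm
    · exact absurd rfl hij
  · intro i
    fin_cases i
    · intro a ha
      exact List.isChain_iff_getElem.1 hl.2.1 a ha
    · intro a ha
      exact List.isChain_iff_getElem.1 hm.2.1 a ha

theorem CF' {S T : Finset V} {a c : ℕ} (hST : Disjoint S T) (h1 : HasP G S a) (h2 : HasP G T c) :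
    ContainsForest G ![c, a] := CF hST.symm h2 h1

/-- join through v -/
theorem joinP {v : V} {C D : Finset V} {j q c : ℕ} (hCD : Disjoint C D) (hvC : v ∉ C) (hvD : v ∉ D)
    (hC : HasPF G (insert v C) v (q + c)) (hD : HasPF G (insert v D) v j) :
    ∃ Q T : Finset V, Q ⊆ C ∧ T ⊆ C ∧ Disjoint Q T ∧ HasP G (insert v (D ∪ Q)) (j + 1 + q) ∧ HasP G T c := by
  obtain ⟨l, hl, hlc⟩ := hC
  obtain ⟨m, hm, rfl⟩ := hD
  have hnd := List.nodup_cons.1 hl.1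
  have hlC : ∀ x ∈ l, x ∈ C := by
    intro x hx
    rcases Finset.mem_insert.1 (hl.2.2 x (by simp [hx])) with h | h
    · subst h; exact absurd hx hnd.1
    · exact h
  have hmem : ∀ x ∈ v :: m, x ∉ l := by
    intro x hx hxl
    have h1 := hlC x hxl
    rcases Finset.mem_insert.1 (hm.2.2 x hx) with h | h
    · subst h; exact hvC h1
    · exact Finset.disjoint_left.1 hCD h1 h
  have hl' : PathIn G C l := by
    have := hl.drop 1
    exact PathIn.sub (by simpa using this) hlC
  refine ⟨(l.take q).toFinset, (l.drop q).toFinset, ?_, ?_, ?_, ?_, ?_⟩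
  · intro x hx; exact hlC x (List.mem_of_mem_take (List.mem_toFinset.1 hx))
  · intro x hx; exact hlC x (List.mem_of_mem_drop (List.mem_toFinset.1 hx))
  · rw [Finset.disjoint_left]
    intro x hx hx'
    rw [List.mem_toFinset] at hx hx'
    have := hnd.2
    rw [← List.take_append_drop q l, List.nodup_append] at this
    exact this.2.2 x hx x hx' rfl
  · refine ⟨(v :: m).reverse ++ l.take q, ?_, by simp; omega⟩
    apply PathIn.append
    · refine PathIn.mono hm.reverse ?_
      apply Finset.insert_subset_insert
      exact Finset.subset_union_left
    · refine (hl'.take q).sub ?_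
      intro x hx
      simp [hx]
    · intro x hx hx'
      exact hmem x (by simpa [or_comm] using hx) (List.mem_of_mem_take hx')
    · intro x hx y hy
      have hx' : x = v := by
        simp at hx; exact hx.symm
      subst hx'
      cases l with
      | nil => simp at hy
      | cons p l =>
        cases q with
        | zero => simp at hy
        | succ q =>
          simp at hy; subst hy
          exact (List.isChain_cons_cons.1 hl.2.1).1
  · exact ⟨l.drop q, (hl'.drop q).sub (by simp), by simp; omega⟩

theorem CFjoin {v : V} {C D : Finset V} {j q c : ℕ} (hCD : Disjoint C D) (hvC : v ∉ C) (hvD : v ∉ D)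
    (hC : HasPF G (insert v C) v (q + c)) (hD : HasPF G (insert v D) v j) :
    ContainsForest G ![j + 1 + q, c] := by
  obtain ⟨Q, T, hQ, hT, hQT, h1, h2⟩ := joinP hCD hvC hvD hC hD
  refine CF ?_ h1 h2
  rw [Finset.disjoint_left]
  intro x hx hxT
  rw [Finset.mem_insert, Finset.mem_union] at hx
  rcases hx with rfl | hx | hx
  · exact hvC (hT hxT)
  · exact Finset.disjoint_left.1 hCD (hT hxT) hx
  · exact Finset.disjoint_left.1 hQT hx hxT

theorem join2 {v : V} {C D : Finset V} {j q : ℕ} (hCD : Disjoint C D) (hvC : v ∉ C) (hvD : v ∉ D)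
    (hC : HasPF G (insert v C) v q) (hD : HasPF G (insert v D) v j) :
    HasP G (insert v (C ∪ D)) (j + 1 + q) := by
  obtain ⟨Q, T, hQ, hT, hQT, h1, h2⟩ := joinP (c := 0) hCD hvC hvD hC hD
  refine h1.mono ?_
  apply Finset.insert_subset_insert
  rw [Finset.union_comm]
  exact Finset.union_subset_union_left hQ

/-- the unbalanced case -/
theorem mainA {h a c : ℕ} (hh : 3 ≤ h) (hac : a + c = 2 * h + 4) (hc3 : 3 ≤ c) (hca : c < a) (hcase : c ≤ h ∨ (c = h + 1 ∧ 4 ≤ h))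
    (hconn : G.Connected) (hcard : 2 * h + 4 ≤ Fintype.card V)
    (hδ : ∀ v, h ≤ G.degree v) {v x y : V} (hx : x ≠ v) (hy : y ≠ v)
    (hxy : comp G (Finset.univ.erase v) x ≠ comp G (Finset.univ.erase v) y) :
    ContainsForest G ![a, c] ∨
    (c = h + 1 ∧ ∀ z, z ≠ v → (comp G (Finset.univ.erase v) z).card = h ∧
      ∀ p ∈ insert v (comp G (Finset.univ.erase v) z), ∀ q ∈ insert v (comp G (Finset.univ.erase v) z), p ≠ q → G.Adj p q) := by
  by_cases hall : ∀ z, z ≠ v → (comp G (Finset.univ.erase v) z).card = h ∧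
      ∀ p ∈ insert v (comp G (Finset.univ.erase v) z), ∀ q ∈ insert v (comp G (Finset.univ.erase v) z), p ≠ q → G.Adj p q
  · by_cases hch : c = h + 1
    · exact Or.inr ⟨hch, hall⟩
    -- c ≤ h; there are three components
    left
    have hcle : c ≤ h := by omega
    have h3 : ∃ z, z ≠ v ∧ comp G (Finset.univ.erase v) z ≠ comp G (Finset.univ.erase v) x ∧
        comp G (Finset.univ.erase v) z ≠ comp G (Finset.univ.erase v) y := by
      by_contra hcon
      push Not at hcon
      have hsub : Finset.univ ⊆ insert v (comp G (Finset.univ.erase v) x ∪ comp G (Finset.univ.erase v) y) := by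
        intro z _
        by_cases hz : z = v
        · simp [hz]
        · by_cases hzx : comp G (Finset.univ.erase v) z = comp G (Finset.univ.erase v) x
          · rw [← hzx]
            have := self_comp (G := G) (S := Finset.univ.erase v) (x := z) (by simp [hz])
            simp [this]
          · rw [← hcon z hz hzx]
            have := self_comp (G := G) (S := Finset.univ.erase v) (x := z) (by simp [hz])
            simp [this]
      have h1 := Finset.card_le_card hsub
      have h2 := Finset.card_insert_le v (comp G (Finset.univ.erase v) x ∪ comp G (Finset.univ.erase v) y)
      have h3 := Finset.card_union_le (comp G (Finset.univ.erase v) x) (comp G (Finset.univ.erase v) y)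
      rw [Finset.card_univ] at h1
      have := (hall x hx).1
      have := (hall y hy).1
      omega
    obtain ⟨z, hz, hzx, hzy⟩ := h3
    have bx := Br_comp hconn hx
    have bY := Br_comp hconn hy
    have bz := Br_comp hconn hz
    have p := join2 (comp_disj hxy) bx.nv bY.nv (branch_path (by omega) hδ bx).1 (branch_path (by omega) hδ bY).1
    refine CF ?_ (p.le (by omega)) ((branch_path (by omega) hδ bz).1.tail.le hcle)
    rw [Finset.disjoint_insert_left, Finset.disjoint_union_left]
    exact ⟨bz.nv, (comp_disj hzx).symm, (comp_disj hzy).symm⟩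
  · left
    push Not at hall
    obtain ⟨z, hz, hznot⟩ := hall
    have bz := Br_comp hconn hz
    have pz1 : HasPF G (insert v (comp G (Finset.univ.erase v) z)) v (h+1) := by
      rcases (branch_path (by omega) hδ bz).2 with h | ⟨h1, h2⟩
      · exact h
      · obtain ⟨p, hp, q, hq, hpq, hn⟩ := hznot h1
        exact absurd (h2 p hp q hq hpq) hn
    -- another component
    have hw : ∃ w, w ≠ v ∧ comp G (Finset.univ.erase v) w ≠ comp G (Finset.univ.erase v) z := by
      by_cases hzx : comp G (Finset.univ.erase v) x = comp G (Finset.univ.erase v) z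
      · exact ⟨y, hy, fun he => hxy (hzx.trans he.symm)⟩
      · exact ⟨x, hx, hzx⟩
    obtain ⟨w, hw, hwz⟩ := hw
    have bw := Br_comp hconn hw
    by_cases h3 : ∃ u, u ≠ v ∧ comp G (Finset.univ.erase v) u ≠ comp G (Finset.univ.erase v) w ∧
        comp G (Finset.univ.erase v) u ≠ comp G (Finset.univ.erase v) z
    · obtain ⟨u, hu, huw, huz⟩ := h3
      have bu := Br_comp hconn hu
      have p := join2 (comp_disj huw) bu.nv bw.nv (branch_path (by omega) hδ bu).1 (branch_path (by omega) hδ bw).1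
      refine CF ?_ (p.le (by omega)) (pz1.tail.le (by omega))
      rw [Finset.disjoint_insert_left, Finset.disjoint_union_left]
      exact ⟨bz.nv, (comp_disj huz), (comp_disj hwz)⟩
    · push Not at h3
      have hdisj := comp_disj hwz
      generalize hCe : comp G (Finset.univ.erase v) z = C0 at *
      generalize hDe : comp G (Finset.univ.erase v) w = D0 at *
      have hcardsum : Fintype.card V ≤ C0.card + D0.card + 1 := by
        have hsub : Finset.univ ⊆ insert v (C0 ∪ D0) := by
          intro u _
          by_cases huv : u = v
          · simp [huv]
          · have hself := self_comp (G := G) (S := Finset.univ.erase v) (x := u) (by simp [huv])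
            by_cases huw : comp G (Finset.univ.erase v) u = D0
            · rw [huw] at hself; simp [hself]
            · rw [h3 u huv huw] at hself; simp [hself]
        have h1 := Finset.card_le_card hsub
        have h2 := Finset.card_insert_le v (C0 ∪ D0)
        have h3 := Finset.card_union_le C0 D0
        rw [Finset.card_univ] at h1
        omega
      have fin : ∀ C D : Finset V, Br G v C → Br G v D → Disjoint C D → D.card ≤ C.card →
          Fintype.card V ≤ C.card + D.card + 1 → ContainsForest G ![a, c] := by
        intro C D bC bD hCD hle hsum
        obtain ⟨pD, pD'⟩ := branch_path (by omega) hδ bD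
        rcases lemX (by omega) hδ bC with hX | hX
        · rcases pD' with hD | hD
          · have := CFjoin (j := h+1) (q := a - h - 2) (c := c) hCD bC.nv bD.nv (hX.le (by omega)) hD
            rwa [show h + 1 + 1 + (a - h - 2) = a by omega] at this
          · have := hD.1
            have := CFjoin (j := h) (q := a - h - 1) (c := c) hCD bC.nv bD.nv (hX.le (by omega)) pD
            rwa [show h + 1 + (a - h - 1) = a by omega] at this
        · have hd1 : Disjoint (insert v C) D := by
            rw [Finset.disjoint_insert_left]; exact ⟨bD.nv, hCD⟩
          rcases pD' with hD | hD
          · exact CF hd1 (hX.le (by omega)) (hD.tail.le (by omega))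
          · rcases hcase with hc | ⟨hc, h4⟩
            · exact CF hd1 (hX.le (by omega)) (pD.tail.le (by omega))
            · have hd2 : Disjoint C (insert v D) := by
                rw [Finset.disjoint_insert_right]; exact ⟨bC.nv, hCD⟩
              refine CF hd2 ?_ (pD.toP.le (by omega))
              rcases dirac bC.cc (fun a ha => bC.deg' hδ ha) with h | h
              · exact h.le (by omega)
              · exact h.le (by omega)
      rcases le_total D0.card C0.card with hle | hle
      · exact fin C0 D0 bz bw hdisj.symm hle hcardsum
      · exact fin D0 C0 bw bz hdisj hle (by omega)

end helpers3
section helpers4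
variable {V : Type*} [Fintype V] [DecidableEq V] {G : SimpleGraph V} [DecidableRel G.Adj]

theorem exists_off {α : Type*} (s : Finset α) : ∃ g : α → ℕ, Set.InjOn g s ∧ ∀ x ∈ s, g x < s.card := by
  classical
  refine ⟨fun x => if hx : x ∈ s then (s.equivFin ⟨x, hx⟩).val else 0, ?_, ?_⟩
  · intro x hx y hy hxy
    have hx' : x ∈ s := hx
    have hy' : y ∈ s := hy
    simp only [hx', hy', dif_pos] at hxy
    have := s.equivFin.injective (Fin.ext hxy)
    simpa using this
  · intro x hx
    simp only [hx, dif_pos]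
    exact (s.equivFin ⟨x, hx⟩).isLt

theorem exists_off0 {α : Type*} (s : Finset α) {a : α} (ha : a ∈ s) :
    ∃ g : α → ℕ, Set.InjOn g s ∧ (∀ x ∈ s, g x < s.card) ∧ ∀ x ∈ s, (g x = 0 ↔ x = a) := by
  classical
  obtain ⟨g, hg, hlt⟩ := exists_off (s.erase a)
  have hc := Finset.card_erase_of_mem ha
  have hpos : 0 < s.card := Finset.card_pos.2 ⟨a, ha⟩
  refine ⟨fun x => if x = a then 0 else g x + 1, ?_, ?_, ?_⟩
  · intro x hx y hy hxy
    by_cases h1 : x = a <;> by_cases h2 : y = a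
    · rw [h1, h2]
    · simp [h1, h2] at hxy
    · simp [h1, h2] at hxy
    · simp [h1, h2] at hxy
      exact hg (by simp [h1]; exact hx) (by simp [h2]; exact hy) hxy
  · intro x hx
    by_cases h1 : x = a
    · simp [h1, hpos]
    · have := hlt x (by simp [h1, hx])
      simp [h1]; omega
  · intro x hx
    by_cases h1 : x = a <;> simp [h1]

theorem embL {h : ℕ} (hh : 1 ≤ h) (c : V)
    (hall : ∀ z, z ≠ c → (comp G (Finset.univ.erase c) z).card = h ∨ (comp G (Finset.univ.erase c) z).card = h + 1) :
    ∃ t₁ t₂, ∃ f : V → Fin (t₁ * h + t₂ * (h + 1) + 1), Function.Injective f ∧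
      Fintype.card V = t₁ * h + t₂ * (h + 1) + 1 ∧ (∀ x, (f x).val = 0 ↔ x = c) ∧
      (∀ x y, x ≠ c → y ≠ c → (blockIdx t₁ h (f x).val = blockIdx t₁ h (f y).val ↔
        comp G (Finset.univ.erase c) x = comp G (Finset.univ.erase c) y)) ∧
      ((∀ z, z ≠ c → (comp G (Finset.univ.erase c) z).card = h) → t₂ = 0) := by
  classical
  set K : V → Finset V := comp G (Finset.univ.erase c) with hK
  have hself : ∀ z, z ≠ c → z ∈ K z := fun z hz => self_comp (by simp [hz])
  let I1 := ((Finset.univ.erase c).filter (fun z => (K z).card = h)).image K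
  let I2 := ((Finset.univ.erase c).filter (fun z => (K z).card = h + 1)).image K
  have m1 : ∀ z, z ≠ c → (K z).card = h → K z ∈ I1 := by
    intro z hz hc
    exact Finset.mem_image_of_mem _ (by simp [hz, hc])
  have m2 : ∀ z, z ≠ c → (K z).card ≠ h → K z ∈ I2 := by
    intro z hz hc
    have := (hall z hz).resolve_left hc
    exact Finset.mem_image_of_mem _ (by simp [hz, this])
  have s1 : ∀ s ∈ I1, s.card = h ∧ ∃ z, z ≠ c ∧ K z = s := by
    intro s hs
    simp only [I1, Finset.mem_image, Finset.mem_filter, Finset.mem_erase, Finset.mem_univ, and_true] at hs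
    obtain ⟨z, ⟨h1, h2⟩, rfl⟩ := hs
    exact ⟨h2, z, h1, rfl⟩
  have s2 : ∀ s ∈ I2, s.card = h + 1 ∧ ∃ z, z ≠ c ∧ K z = s := by
    intro s hs
    simp only [I2, Finset.mem_image, Finset.mem_filter, Finset.mem_erase, Finset.mem_univ, and_true] at hs
    obtain ⟨z, ⟨h1, h2⟩, rfl⟩ := hs
    exact ⟨h2, z, h1, rfl⟩
  obtain ⟨g1, hg1, lt1⟩ := exists_off I1
  obtain ⟨g2, hg2, lt2⟩ := exists_off I2
  choose off hoff ltoff using fun s : Finset V => exists_off s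
  let B : V → ℕ := fun x => if (K x).card = h then g1 (K x) else I1.card + g2 (K x)
  let F : V → ℕ := fun x => if x = c then 0 else if (K x).card = h then 1 + (g1 (K x) * h + off (K x) x)
    else 1 + (I1.card * h + (g2 (K x) * (h+1) + off (K x) x))
  have F0 : ∀ x, F x = 0 ↔ x = c := by
    intro x
    by_cases hx : x = c
    · simp [F, hx]
    · simp only [F, hx, if_false, iff_false]
      split_ifs <;> omega
  have Flt : ∀ x, F x < I1.card * h + I2.card * (h+1) + 1 := by
    intro x
    by_cases hx : x = c
    · simp [F, hx]
    · by_cases hc : (K x).card = h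
      · have e1 := lt1 _ (m1 x hx hc)
        have e2 := ltoff (K x) x (hself x hx)
        have e3 : (g1 (K x) + 1) * h ≤ I1.card * h := Nat.mul_le_mul_right _ e1
        simp only [F, hx, hc, if_false, if_true]
        rw [Nat.add_mul] at e3
        have : 0 ≤ I2.card * (h+1) := Nat.zero_le _
        omega
      · have e1 := lt2 _ (m2 x hx hc)
        have e2 := ltoff (K x) x (hself x hx)
        have e4 := (hall x hx).resolve_left hc
        have e3 : (g2 (K x) + 1) * (h+1) ≤ I2.card * (h+1) := Nat.mul_le_mul_right _ e1
        simp only [F, hx, hc, if_false]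
        rw [Nat.add_mul] at e3
        omega
  have FB : ∀ x, x ≠ c → blockIdx I1.card h (F x) = B x := by
    intro x hx
    by_cases hc : (K x).card = h
    · have e1 := lt1 _ (m1 x hx hc)
      have e2 := ltoff (K x) x (hself x hx)
      have e3 : (g1 (K x) + 1) * h ≤ I1.card * h := Nat.mul_le_mul_right _ e1
      simp only [F, B, hx, hc, if_false, if_true, blockIdx]
      rw [Nat.add_sub_cancel_left, if_pos (by rw [Nat.add_mul] at e3; omega)]
      rw [Nat.add_comm, Nat.add_mul_div_right _ _ (by omega), Nat.div_eq_of_lt (by omega), Nat.zero_add]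
    · have e2 := ltoff (K x) x (hself x hx)
      have e4 := (hall x hx).resolve_left hc
      simp only [F, B, hx, hc, if_false, blockIdx]
      rw [Nat.add_sub_cancel_left, if_neg (by omega), Nat.add_sub_cancel_left]
      rw [Nat.add_comm (g2 (K x) * (h+1)), Nat.add_mul_div_right _ _ (by omega), Nat.div_eq_of_lt (by omega), Nat.zero_add]
  have BK : ∀ x y, x ≠ c → y ≠ c → (B x = B y ↔ K x = K y) := by
    intro x y hx hy
    constructor
    · intro hB
      by_cases hcx : (K x).card = h <;> by_cases hcy : (K y).card = h
      · simp only [B, hcx, hcy, if_true] at hB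
        exact hg1 (m1 x hx hcx) (m1 y hy hcy) hB
      · have e1 := lt1 _ (m1 x hx hcx)
        simp only [B, hcx, hcy, if_true, if_false] at hB
        omega
      · have e1 := lt1 _ (m1 y hy hcy)
        simp only [B, hcx, hcy, if_true, if_false] at hB
        omega
      · simp only [B, hcx, hcy, if_false] at hB
        exact hg2 (m2 x hx hcx) (m2 y hy hcy) (by omega)
    · intro he
      simp only [B, he]
  have Finj : Function.Injective F := by
    intro x y hxy
    by_cases hx : x = c
    · have : F x = 0 := (F0 x).2 hx
      rw [hxy] at this
      rw [hx, (F0 y).1 this]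
    · have hy : y ≠ c := by
        intro hy
        have : F y = 0 := (F0 y).2 hy
        rw [← hxy] at this
        exact hx ((F0 x).1 this)
      have he : K x = K y := by
        rw [← BK x y hx hy, ← FB x hx, ← FB y hy, hxy]
      have ho : off (K x) x = off (K x) y := by
        simp only [F, hx, hy, if_false, he] at hxy
        rw [he]
        split_ifs at hxy <;> omega
      exact hoff (K x) (hself x hx) (by rw [he]; exact hself y hy) ho
  refine ⟨I1.card, I2.card, fun x => ⟨F x, Flt x⟩, ?_, ?_, ?_, ?_, ?_⟩
  · intro x y hxy
    exact Finj (by simpa using hxy)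
  · have hmaps : Set.MapsTo K ((Finset.univ.erase c : Finset V) : Set V) ((I1 ∪ I2 : Finset (Finset V)) : Set (Finset V)) := by
      intro x hx
      have hx' : x ≠ c := by simpa using hx
      rw [Finset.mem_coe, Finset.mem_union]
      by_cases hc : (K x).card = h
      · exact Or.inl (m1 x hx' hc)
      · exact Or.inr (m2 x hx' hc)
    have hfib := Finset.card_eq_sum_card_fiberwise hmaps
    have hf : ∀ s ∈ I1 ∪ I2, ((Finset.univ.erase c).filter (fun x => K x = s)).card = s.card := by
      intro s hs
      have : ∃ z, z ≠ c ∧ K z = s := by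
        rcases Finset.mem_union.1 hs with h | h
        · exact (s1 s h).2
        · exact (s2 s h).2
      obtain ⟨z, hz, rfl⟩ := this
      congr 1
      ext x
      rw [Finset.mem_filter]
      constructor
      · rintro ⟨h1, h2⟩
        rw [← h2]; exact hself x (by simpa using h1)
      · intro hx
        exact ⟨comp_sub hx, comp_eq hx⟩
    rw [Finset.sum_congr rfl hf, Finset.sum_union (by
      rw [Finset.disjoint_left]
      intro s hs hs'
      have := (s1 s hs).1
      have := (s2 s hs').1
      omega), Finset.sum_congr rfl (fun s hs => (s1 s hs).1), Finset.sum_congr rfl (fun s hs => (s2 s hs).1),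
      Finset.sum_const, Finset.sum_const, Finset.card_erase_of_mem (Finset.mem_univ _), Finset.card_univ] at hfib
    have : 0 < Fintype.card V := Fintype.card_pos_iff.2 ⟨c⟩
    simp only [smul_eq_mul] at hfib
    omega
  · intro x; exact F0 x
  · intro x y hx hy
    rw [← BK x y hx hy, ← FB x hx, ← FB y hy]
  · intro hz
    rw [Finset.card_eq_zero]
    by_contra hne
    obtain ⟨s, hs⟩ := Finset.nonempty_iff_ne_empty.2 hne
    obtain ⟨e1, z, hzc, rfl⟩ := s2 s hs
    have := hz z hzc
    omega

theorem L_sub {h : ℕ} (hh : 1 ≤ h) (c : V)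
    (hall : ∀ z, z ≠ c → (comp G (Finset.univ.erase c) z).card = h ∨ (comp G (Finset.univ.erase c) z).card = h + 1) :
    ∃ t₁ t₂, Fintype.card V = t₁ * h + t₂ * (h + 1) + 1 ∧ SubgraphOf G (Lgen t₁ t₂ h) := by
  obtain ⟨t₁, t₂, f, hf, hc, h0, hb, -⟩ := embL hh c hall
  refine ⟨t₁, t₂, hc, ⟨f, hf⟩, ?_⟩
  intro a b hab
  simp only [Lgen, SimpleGraph.fromRel_adj, Function.Embedding.coeFn_mk]
  refine ⟨fun he => hab.ne (hf he), ?_⟩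
  by_cases ha : a = c
  · exact Or.inl (Or.inl ((h0 a).2 ha))
  · by_cases hbc : b = c
    · exact Or.inr (Or.inl ((h0 b).2 hbc))
    · left; right
      rw [hb a b ha hbc]
      have : b ∈ comp G (Finset.univ.erase c) a := comp_cl (self_comp (by simp [ha])) (by simp [hbc]) hab
      exact (comp_eq this).symm

theorem L_iso {h : ℕ} (hh : 1 ≤ h) (c : V)
    (hall : ∀ z, z ≠ c → (comp G (Finset.univ.erase c) z).card = h ∧
      ∀ p ∈ insert c (comp G (Finset.univ.erase c) z), ∀ q ∈ insert c (comp G (Finset.univ.erase c) z), p ≠ q → G.Adj p q) :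
    ∃ t, Fintype.card V = t * h + 1 ∧ Nonempty (G ≃g Lgen t 0 h) := by
  obtain ⟨t₁, t₂, f, hf, hc, h0, hb, ht⟩ := embL hh c (fun z hz => Or.inl (hall z hz).1)
  have := ht (fun z hz => (hall z hz).1)
  subst this
  refine ⟨t₁, by simpa using hc, ?_⟩
  have hbij : Function.Bijective f := (Fintype.bijective_iff_injective_and_card f).2 ⟨hf, by rw [hc]; simp⟩
  refine ⟨⟨Equiv.ofBijective f hbij, ?_⟩⟩
  intro a b
  simp only [Equiv.ofBijective_apply, Lgen, SimpleGraph.fromRel_adj, h0]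
  have hself : ∀ z, z ≠ c → z ∈ comp G (Finset.univ.erase c) z := fun z hz => self_comp (by simp [hz])
  constructor
  · rintro ⟨hne, hor⟩
    have hab : a ≠ b := fun he => hne (by rw [he])
    by_cases ha : a = c
    · subst ha
      exact (hall b hab.symm).2 a (by simp) b (by simp [hself b hab.symm]) hab
    · by_cases hbc : b = c
      · subst hbc
        exact (hall a ha).2 a (by simp [hself a ha]) b (by simp) hab
      · have he : comp G (Finset.univ.erase c) a = comp G (Finset.univ.erase c) b := by
          rcases hor with (h | h) | (h | h)
          · exact absurd h ha
          · exact (hb a b ha hbc).1 h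
          · exact absurd h hbc
          · exact ((hb b a hbc ha).1 h).symm
        exact (hall a ha).2 a (by simp [hself a ha]) b (by rw [he]; simp [hself b hbc]) hab
  · intro hab
    refine ⟨fun he => hab.ne (hf he), ?_⟩
    by_cases ha : a = c
    · exact Or.inl (Or.inl ha)
    · by_cases hbc : b = c
      · exact Or.inr (Or.inl hbc)
      · left; right
        rw [hb a b ha hbc]
        have : b ∈ comp G (Finset.univ.erase c) a := comp_cl (hself a ha) (by simp [hbc]) hab
        exact (comp_eq this).symm

theorem U_iso {h : ℕ} (ι : V → Fin 3) (sp : Fin 3 → V) (hsp : ∀ i, ι (sp i) = i)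
    (hcard : ∀ i, (Finset.univ.filter (fun x => ι x = i)).card = h + 1)
    (hadj : ∀ x y, x ≠ y → (G.Adj x y ↔ (ι x = ι y ∨ (x = sp (ι x) ∧ y = sp (ι y))))) :
    Nonempty (G ≃g Ugraph h) := by
  choose off hoff ltoff off0 using fun i : Fin 3 => exists_off0 (Finset.univ.filter (fun x => ι x = i)) (a := sp i) (by simp [hsp])
  have lt' : ∀ x, off (ι x) x < h + 1 := fun x => by
    have := ltoff (ι x) x (by simp)
    rwa [hcard] at this
  have z' : ∀ x, off (ι x) x = 0 ↔ x = sp (ι x) := fun x => off0 (ι x) x (by simp)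
  let F : V → Fin (3 * (h+1)) := fun x => ⟨off (ι x) x + (ι x).val * (h+1), by
    have h1 := lt' x
    have h2 : ((ι x).val + 1) * (h+1) ≤ 3 * (h+1) := Nat.mul_le_mul_right _ (ι x).isLt
    rw [Nat.add_mul] at h2
    omega⟩
  have Fdiv : ∀ x, (F x).val / (h+1) = (ι x).val := by
    intro x
    simp only [F]
    rw [Nat.add_mul_div_right _ _ (by omega), Nat.div_eq_of_lt (lt' x), Nat.zero_add]
  have Fmod : ∀ x, (F x).val % (h+1) = off (ι x) x := by
    intro x
    simp only [F]
    rw [Nat.add_mul_mod_self_right, Nat.mod_eq_of_lt (lt' x)]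
  have Finj : Function.Injective F := by
    intro x y hxy
    have h1 : ι x = ι y := by
      apply Fin.ext
      rw [← Fdiv, ← Fdiv, hxy]
    have h2 : off (ι x) x = off (ι x) y := by
      conv_rhs => rw [h1]
      rw [← Fmod, ← Fmod, hxy]
    exact hoff (ι x) (by simp) (by simp [h1]) h2
  have hV : Fintype.card V = 3 * (h+1) := by
    rw [← Finset.card_univ, Finset.card_eq_sum_card_fiberwise (f := ι) (t := Finset.univ) (by simp)]
    rw [Finset.sum_congr rfl (fun i _ => hcard i)]
    simp
  have hbij : Function.Bijective F := (Fintype.bijective_iff_injective_and_card F).2 ⟨Finj, by rw [hV]; simp⟩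
  refine ⟨⟨Equiv.ofBijective F hbij, ?_⟩⟩
  intro a b
  simp only [Equiv.ofBijective_apply, Ugraph, SimpleGraph.fromRel_adj, Fdiv, Fmod, z', Fin.val_inj]
  by_cases hab : a = b
  · subst hab; simp
  · rw [hadj a b hab]
    have : F a ≠ F b := fun he => hab (Finj he)
    constructor
    · rintro ⟨-, h⟩
      rcases h with (h | h) | (h | h)
      · exact Or.inl h
      · exact Or.inr h
      · exact Or.inl h.symm
      · exact Or.inr h.symm
    · intro h
      exact ⟨this, Or.inl h⟩

end helpers4
section helpers5
variable {V : Type*} [Fintype V] [DecidableEq V] {G : SimpleGraph V} [DecidableRel G.Adj]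

theorem p5 {S : Finset V} {a b c d e : V} (hn : [a, b, c, d, e].Nodup) (h1 : G.Adj a b) (h2 : G.Adj b c)
    (h3 : G.Adj c d) (h4 : G.Adj d e) (hm : ∀ x ∈ [a, b, c, d, e], x ∈ S) : HasP G S 5 :=
  ⟨[a, b, c, d, e], ⟨hn, by simp [h1, h2, h3, h4], hm⟩, rfl⟩

theorem p4 {S : Finset V} {a b c d : V} (hn : [a, b, c, d].Nodup) (h1 : G.Adj a b) (h2 : G.Adj b c)
    (h3 : G.Adj c d) (hm : ∀ x ∈ [a, b, c, d], x ∈ S) : HasP G S 4 :=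
  ⟨[a, b, c, d], ⟨hn, by simp [h1, h2, h3], hm⟩, rfl⟩

theorem deg_le_of {a : V} {A : Finset V} (hA : ∀ b, G.Adj a b → b ∈ A) : G.degree a ≤ A.card := by
  apply Finset.card_le_card
  intro x hx
  rw [SimpleGraph.mem_neighborFinset] at hx
  exact hA x hx

theorem star3 (hδ : ∀ v, 3 ≤ G.degree v) {C E : Finset V} {v x : V} (hE : CC G E) (hEC : E ⊆ C.erase x)
    (hvC : v ∉ C) (hxC : x ∈ C) (hcl : ∀ a ∈ E, ∀ b, G.Adj a b → b = x ∨ b = v ∨ b ∈ E) (hcard : 5 ≤ E.card)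
    (hvx : G.Adj v x) (hNP : ∀ z ∈ C, G.Adj v z → ¬ HasP G (C.erase z) 5) : False := by
  have hno5 : ¬ HasP G E 5 := fun h => hNP x hxC hvx (h.mono hEC)
  have hxE : x ∉ E := fun h => by simpa using hEC h
  have hEC' : ∀ z ∈ E, z ∈ C := fun z hz => Finset.mem_of_mem_erase (hEC hz)
  have low : ∀ a ∈ E, dIn G E a ≤ 1 → G.Adj a x ∧ G.Adj a v := by
    intro a ha hd
    constructor
    · by_contra hn
      have h1 : G.degree a ≤ (insert v (E.filter (G.Adj a))).card := deg_le_of (fun b hb => by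
        rcases hcl a ha b hb with rfl | rfl | h
        · exact absurd hb hn
        · simp
        · simp [h, hb])
      have h2 := Finset.card_insert_le v (E.filter (G.Adj a))
      have h3 := hδ a
      unfold dIn at hd
      omega
    · by_contra hn
      have h1 : G.degree a ≤ (insert x (E.filter (G.Adj a))).card := deg_le_of (fun b hb => by
        rcases hcl a ha b hb with rfl | rfl | h
        · simp
        · exact absurd hb hn
        · simp [h, hb])
      have h2 := Finset.card_insert_le x (E.filter (G.Adj a))
      have h3 := hδ a
      unfold dIn at hd
      omega
  have hd1 : ∀ a ∈ E, 1 ≤ dIn G E a := by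
    intro a ha
    have h1 : G.degree a ≤ (insert x (insert v (E.filter (G.Adj a)))).card := deg_le_of (fun b hb => by
        rcases hcl a ha b hb with rfl | rfl | h
        · simp
        · simp
        · simp [h, hb])
    have h2 := Finset.card_insert_le v (E.filter (G.Adj a))
    have h2' := Finset.card_insert_le x (insert v (E.filter (G.Adj a)))
    have h3 := hδ a
    unfold dIn
    omega
  obtain ⟨k, hk, hmax⟩ := exists_maxP (G := G) (S := E)
  have hk4 : k ≤ 4 := by
    by_contra hcon
    exact hno5 (hk.le (by omega))
  have hk3 : 3 ≤ k := by
    rcases dirac hE hd1 with h | h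
    · exact absurd (h.le hcard) hno5
    · by_contra hcon
      exact hmax (h.le (by omega))
  have hlow : ∃ l a, PathIn G E l ∧ l.length = k ∧ l.head? = some a ∧ dIn G E a ≤ 1 := by
    obtain ⟨l, hl, hlk⟩ := hk
    obtain ⟨a, b, ha, hb⟩ := ends (l := l) (by rintro rfl; simp at hlk; omega)
    have := max_degsum hE hl (by rw [hlk]; exact hmax) (by omega) ha hb
    by_cases h1 : dIn G E a ≤ 1
    · exact ⟨l, a, hl, hlk, ha, h1⟩
    · exact ⟨l.reverse, b, hl.reverse, by simpa using hlk, by simpa using hb, by omega⟩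
  obtain ⟨l, a, hl, hlk, ha, hda⟩ := hlow
  have haE : a ∈ E := hl.2.2 a (List.mem_of_mem_head? ha)
  obtain ⟨hax, hav⟩ := low a haE hda
  have hmax' : ¬ HasP G E (l.length + 1) := by rw [hlk]; exact hmax
  have he1 := max_end hl hmax' ha
  obtain ⟨_, b, -, hb⟩ := ends (l := l) (by rintro rfl; simp at hlk; omega)
  have he2 := max_end' hl hmax' hb
  have hout : ∃ c ∈ l, ∃ r ∈ E, r ∉ l ∧ G.Adj c r := by
    have hcl := List.toFinset_card_of_nodup hl.1
    obtain ⟨c, hc, r, hr, hr', hcr⟩ := hE.2 l.toFinset (fun x hx => hl.2.2 x (List.mem_toFinset.1 hx))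
      ⟨a, List.mem_toFinset.2 (List.mem_of_mem_head? ha)⟩ (by intro h; rw [h] at hcl; omega)
    rw [List.mem_toFinset] at hc hr'
    exact ⟨c, hc, r, hr, hr', hcr⟩
  obtain ⟨c, hc, r, hr, hrl, hcr⟩ := hout
  match l, hl, hlk, ha, hb, he1, he2, hc, hrl, hmax' with
  | [], _, hlk, _, _, _, _, _, _, _ => simp at hlk; omega
  | [_], _, hlk, _, _, _, _, _, _, _ => simp at hlk; omega
  | [_, _], _, hlk, _, _, _, _, _, _, _ => simp at hlk; omega
  | [a', p, q], hl, hlk, ha, hb, he1, he2, hc, hrl, hmax' =>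
    simp at ha hb; subst ha; subst hb
    obtain ⟨hn, hch, hm⟩ := hl
    simp at hn hch hm hrl
    have hno4 : ¬ HasP G E 4 := by simpa using hmax'
    have hcp : G.Adj p r := by
      simp at hc
      rcases hc with rfl | rfl | rfl
      · have := he1 r hr hcr; simp at this; tauto
      · exact hcr
      · have := he2 r hr hcr; simp at this; tauto
    have leaf : ∀ r ∈ E, r ≠ a' → r ≠ p → r ≠ q → G.Adj p r → G.Adj r x ∧ G.Adj r v := by
      intro r hr h1 h2 h3 hpr
      apply low r hr
      have : dIn G E r ≤ ({p} : Finset V).card := dIn_le (fun t ht hrt => by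
        by_contra htp
        simp at htp
        by_cases hta : t = a'
        · subst hta
          have := he1 r hr hrt.symm
          simp at this; tauto
        · have htr := hrt.ne
          exact hno4 (p4 (a := t) (b := r) (c := p) (d := a') (by simp; grind) hrt.symm hpr.symm hch.1.symm (by simp; tauto)))
      simpa using this
    obtain ⟨hrx, hrv⟩ := leaf r hr hrl.1 hrl.2.1 hrl.2.2 hcp
    obtain ⟨s', hs, s, hsE, hsn, hss⟩ := hE.2 {a', p, q, r} (by
      intro z hz; simp at hz; rcases hz with rfl | rfl | rfl | rfl <;> tauto) (by simp) (by
        intro he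
        have := Finset.card_le_four (a := a') (b := p) (c := q) (d := r)
        rw [he] at this; omega)
    simp at hs hsn
    have hps : G.Adj p s := by
      rcases hs with rfl | rfl | rfl | rfl
      · have := he1 s hsE hss; simp at this; tauto
      · exact hss
      · have := he2 s hsE hss; simp at this; tauto
      · exfalso
        have htr := hss.ne
        exact hno4 (p4 (a := s) (b := s') (c := p) (d := a') (by simp; grind) hss.symm hcp.symm hch.1.symm (by simp; tauto))
    obtain ⟨hsx, hsv⟩ := leaf s hsE hsn.1 hsn.2.1 hsn.2.2.1 hps
    refine hNP r (hEC' r hr) hrv.symm (p5 (a := a') (b := x) (c := s) (d := p) (e := q) ?_ hax hsx.symm hps.symm hch.2 ?_)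
    · simp; grind
    · simp; grind
  | [a', p, q, b'], hl, hlk, ha, hb, he1, he2, hc, hrl, hmax' =>
    simp at ha hb; subst ha; subst hb
    obtain ⟨hn, hch, hm⟩ := hl
    simp at hn hch hm hrl
    have hra : ¬ G.Adj r a' := fun h => by
      have := he1 r hr h.symm; simp at this; tauto
    have hrb : ¬ G.Adj r b' := fun h => by
      have := he2 r hr h.symm; simp at this; tauto
    by_cases hrv : G.Adj v r
    · refine hNP r (hEC' r hr) hrv (p5 (a := x) (b := a') (c := p) (d := q) (e := b') ?_ hax.symm hch.1 hch.2.1 hch.2.2 ?_)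
      · simp; grind
      · simp; grind
    · have hpq : ¬ (G.Adj r p ∧ G.Adj r q) := by
        rintro ⟨h1, h2⟩
        exact hno5 (p5 (a := a') (b := p) (c := r) (d := q) (e := b') (by simp; grind) hch.1 h1.symm h2 hch.2.2 (by simp; tauto))
      have ht : ∃ t ∈ E, G.Adj r t ∧ t ≠ p ∧ t ≠ q := by
        by_contra hcon
        push Not at hcon
        have : ∃ y, ∀ b, G.Adj r b → b ∈ ({x, y} : Finset V) := by
          by_cases hp : G.Adj r p
          · refine ⟨p, fun b hb => ?_⟩
            rcases hcl r hr b hb with rfl | rfl | h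
            · simp
            · exact absurd hb.symm hrv
            · by_cases hbp : b = p
              · simp [hbp]
              · have := hcon b h hb hbp
                subst this
                exact absurd ⟨hp, hb⟩ hpq
          · refine ⟨q, fun b hb => ?_⟩
            rcases hcl r hr b hb with rfl | rfl | h
            · simp
            · exact absurd hb.symm hrv
            · by_cases hbp : b = p
              · subst hbp; exact absurd hb hp
              · have := hcon b h hb hbp
                simp [this]
        obtain ⟨y, hy⟩ := this
        have h1 := deg_le_of hy
        have h2 := hδ r
        have h3 := Finset.card_le_two (a := x) (b := y)
        omega
      obtain ⟨t, htE, hrt, htp, htq⟩ := ht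
      have hta : t ≠ a' := by rintro rfl; exact hra hrt
      have htb : t ≠ b' := by rintro rfl; exact hrb hrt
      have htr := hrt.ne
      simp at hc
      rcases hc with rfl | rfl | rfl | rfl
      · exact hra hcr.symm
      · exact hno5 (p5 (a := t) (b := r) (c := c) (d := q) (e := b') (by simp; grind) hrt.symm hcr.symm hch.2.1 hch.2.2 (by simp; tauto))
      · exact hno5 (p5 (a := t) (b := r) (c := c) (d := p) (e := a') (by simp; grind) hrt.symm hcr.symm hch.2.1.symm hch.1.symm (by simp; tauto))
      · exact hrb hcr.symm
  | _ :: _ :: _ :: _ :: _ :: _, _, hlk, _, _, _, _, _, _, _ => simp at hlk; omega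

end helpers5
section helpers6
variable {V : Type*} [Fintype V] [DecidableEq V] {G : SimpleGraph V} [DecidableRel G.Adj]

noncomputable def Fs (G : SimpleGraph V) [DecidableRel G.Adj] (C : Finset V) (x y : V) : Finset V :=
  (C.erase x) \ comp G (C.erase x) y

structure UC (G : SimpleGraph V) [DecidableRel G.Adj] (h : ℕ) (v : V) (C : Finset V) (x y : V) : Prop where
  hh : 3 ≤ h
  hδ : ∀ v, h ≤ G.degree v
  hB : Br G v C
  star : ∀ z ∈ C, G.Adj v z → ∀ u ∈ C.erase z, (comp G (C.erase z) u).card ≤ h + 1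
  hc : h + 3 ≤ C.card
  hx : x ∈ C
  hy : y ∈ C
  hxy : x ≠ y
  hvx : G.Adj v x
  hvy : G.Adj v y

theorem UC.symm {h : ℕ} {v x y : V} {C : Finset V} (H : UC G h v C x y) : UC G h v C y x :=
  ⟨H.hh, H.hδ, H.hB, H.star, H.hc, H.hy, H.hx, H.hxy.symm, H.hvy, H.hvx⟩

theorem mem_Fs {C : Finset V} {x y a : V} : a ∈ Fs G C x y ↔ a ≠ x ∧ a ∈ C ∧ a ∉ comp G (C.erase x) y := by
  unfold Fs; simp [and_assoc]

theorem Fs_nb {v x y : V} {C : Finset V} (hB : Br G v C) {a b : V} (ha : a ∈ Fs G C x y) (hab : G.Adj a b) :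
    b = v ∨ b = x ∨ b ∈ Fs G C x y := by
  rw [mem_Fs] at ha ⊢
  rcases hB.cl a ha.2.1 b hab with h | h
  · exact Or.inl h
  · right
    by_cases hb : b = x
    · exact Or.inl hb
    · right
      refine ⟨hb, h, fun hbc => ha.2.2 (comp_cl hbc ?_ hab.symm)⟩
      simp [ha.1, ha.2.1]

theorem Fs_G1 {v x y z : V} {C : Finset V} (hB : Br G v C) (hx : x ∈ C) (hz : z ∉ Fs G C x y) (hzx : z ≠ x) :
    Fs G C x y ⊆ comp G (C.erase z) x := by
  by_contra hcon
  obtain ⟨a0, ha0, ha0'⟩ := Finset.not_subset.1 hcon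
  have hxA : x ∉ Fs G C x y \ comp G (C.erase z) x := by simp [mem_Fs]
  obtain ⟨a, ha, b, hb, hbA, hab⟩ := hB.cc.2 (Fs G C x y \ comp G (C.erase z) x)
    (fun t ht => (mem_Fs.1 (Finset.mem_sdiff.1 ht).1).2.1) ⟨a0, by simp [ha0, ha0']⟩
    (by intro h; rw [h] at hxA; exact hxA hx)
  rw [Finset.mem_sdiff] at ha hbA
  have haz : a ≠ z := by rintro rfl; exact hz ha.1
  have haC : a ∈ C.erase z := by simp [haz, (mem_Fs.1 ha.1).2.1]
  have hbc : b ∈ comp G (C.erase z) x := by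
    rcases Fs_nb hB ha.1 hab with rfl | rfl | h
    · exact absurd hb hB.nv
    · exact self_comp (by simp [hb, hzx.symm])
    · by_contra h'; exact hbA ⟨h, h'⟩
  exact ha.2 (comp_cl hbc haC hab.symm)


theorem UC.card_F {h : ℕ} {v x y : V} {C : Finset V} (H : UC G h v C x y) : h - 1 ≤ (Fs G C x y).card := by
  have h1 := H.star x H.hx H.hvx y (by simp [H.hy, H.hxy.symm])
  have h2 := Finset.card_erase_of_mem H.hx
  have h3 := Finset.le_card_sdiff (comp G (C.erase x) y) (C.erase x)
  have h4 := H.hc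
  have hne : (Fs G C x y).Nonempty := by
    rw [← Finset.card_pos]; unfold Fs; omega
  obtain ⟨a, ha⟩ := hne
  have h5 : G.degree a ≤ (insert v (insert x ((Fs G C x y).erase a))).card := deg_le_of (fun b hb => by
    have := hb.ne
    rcases Fs_nb H.hB ha hb with h | h | h <;> simp [h, this.symm])
  have h6 := Finset.card_insert_le v (insert x ((Fs G C x y).erase a))
  have h7 := Finset.card_insert_le x ((Fs G C x y).erase a)
  have h8 := Finset.card_erase_add_one ha
  have h9 := H.hδ a
  omega

theorem UC.notx {h : ℕ} {v x y : V} {C : Finset V} (H : UC G h v C x y) : x ∉ Fs G C x y := by simp [mem_Fs]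

theorem UC.noty {h : ℕ} {v x y : V} {C : Finset V} (H : UC G h v C x y) : y ∉ Fs G C x y := by
  rw [mem_Fs]
  rintro ⟨-, -, h⟩
  exact h (self_comp (by simp [H.hy, H.hxy.symm]))

theorem UC.subE {h : ℕ} {v x y : V} {C : Finset V} (H : UC G h v C x y) : Fs G C y x ⊆ comp G (C.erase x) y :=
  Fs_G1 H.hB H.hy H.symm.noty H.hxy

theorem UC.disj {h : ℕ} {v x y : V} {C : Finset V} (H : UC G h v C x y) {a : V} (ha : a ∈ Fs G C y x) : a ∉ Fs G C x y := fun h =>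
  (mem_Fs.1 h).2.2 (H.subE ha)

/-- the rest -/
theorem UC.rest_card {h : ℕ} {v x y : V} {C : Finset V} (H : UC G h v C x y) : (Fs G C y x).card + ((((C.erase x).erase y) \ Fs G C x y) \ Fs G C y x).card ≤ h := by
  have h1 := H.star x H.hx H.hvx y (by simp [H.hy, H.hxy.symm])
  have hyE : y ∈ comp G (C.erase x) y := self_comp (by simp [H.hy, H.hxy.symm])
  have h2 := Finset.card_erase_add_one hyE
  rw [← Finset.card_union_of_disjoint Finset.disjoint_sdiff]
  have : (Fs G C y x ∪ ((((C.erase x).erase y) \ Fs G C x y) \ Fs G C y x)) ⊆ (comp G (C.erase x) y).erase y := by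
    intro a ha
    rw [Finset.mem_union] at ha
    rcases ha with ha | ha
    · exact Finset.mem_erase.2 ⟨(mem_Fs.1 ha).1, H.subE ha⟩
    · simp [mem_Fs] at ha
      simp
      tauto
  have := Finset.card_le_card this
  omega

theorem UC.rest {h : ℕ} {v x y : V} {C : Finset V} (H : UC G h v C x y) {r : V} (hr : r ∈ C) (hrx : r ≠ x) (hry : r ≠ y) (h1 : r ∉ Fs G C x y) (h2 : r ∉ Fs G C y x) :
    G.Adj r x ∧ G.Adj r y := by
  have hc := H.rest_card
  have hf := H.symm.card_F
  have hh := H.hh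
  have hrR : r ∈ ((((C.erase x).erase y) \ Fs G C x y) \ Fs G C y x) := by simp; tauto
  have hR : ∀ s ∈ ((((C.erase x).erase y) \ Fs G C x y) \ Fs G C y x), s = r := by
    intro s hs
    exact Finset.card_le_one.1 (by omega) s hs r hrR
  have hN : ∀ b, G.Adj r b → b = x ∨ b = y ∨ b = v := by
    intro b hb
    by_contra hcon
    push Not at hcon
    obtain ⟨hbx, hby, hbv⟩ := hcon
    have hbC : b ∈ C := (H.hB.cl r hr b hb).resolve_left hbv
    have hrv : r ≠ v := by rintro rfl; exact H.hB.nv hr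
    have hb1 : b ∉ Fs G C x y := fun h => by
      rcases Fs_nb H.hB h hb.symm with h | h | h <;> tauto
    have hb2 : b ∉ Fs G C y x := fun h => by
      rcases Fs_nb H.hB h hb.symm with h | h | h <;> tauto
    exact hb.ne (hR b (by simp; tauto)).symm
  have key : ∀ s t : V, (∀ b, G.Adj r b → b ∈ ({s, t} : Finset V)) → False := by
    intro s t hst
    have := deg_le_of hst
    have := H.hδ r
    have := Finset.card_le_two (a := s) (b := t)
    omega
  constructor
  · by_contra hn
    refine key y v (fun b hb => ?_)
    rcases hN b hb with rfl | rfl | rfl <;> simp_all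
  · by_contra hn
    refine key x v (fun b hb => ?_)
    rcases hN b hb with rfl | rfl | rfl <;> simp_all

theorem UC.adj_xy {h : ℕ} {v x y : V} {C : Finset V} (H : UC G h v C x y) (hR : ∀ r ∈ C, r ≠ x → r ≠ y → r ∉ Fs G C x y → r ∈ Fs G C y x) : G.Adj x y := by
  obtain ⟨a, ha, b, hb, hbA, hab⟩ := H.hB.cc.2 (insert x (Fs G C x y))
    (fun t ht => by
      rcases Finset.mem_insert.1 ht with rfl | ht
      · exact H.hx
      · exact (mem_Fs.1 ht).2.1) (by simp) (by
        intro he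
        have h1 := H.hy
        rw [← he, Finset.mem_insert] at h1
        rcases h1 with h1 | h1
        · exact H.hxy h1.symm
        · exact H.noty h1)
  rw [Finset.mem_insert] at ha hbA
  push Not at hbA
  have hbv : b ≠ v := by rintro rfl; exact H.hB.nv hb
  have hxv : x ≠ v := by rintro rfl; exact H.hB.nv H.hx
  rcases ha with rfl | ha
  · by_cases hby : b = y
    · subst hby; exact hab
    · have h1 := hR b hb hbA.1 hby hbA.2
      rcases Fs_nb H.hB h1 hab.symm with h | h | h
      · exact absurd h hxv
      · exact absurd h H.hxy
      · exact absurd h H.symm.noty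
  · rcases Fs_nb H.hB ha hab with h | h | h <;> tauto

theorem UC.U1 {h : ℕ} {v x y : V} {C : Finset V} (H : UC G h v C x y) {z : V} (hz : z ∈ Fs G C x y) (hvz : G.Adj v z) :
    (Fs G C y x).card ≤ h - 1 ∧ ∀ w ∈ Fs G C x y, w ≠ z → ¬ G.Adj x w := by
  have hzm := mem_Fs.1 hz
  have hzy : z ≠ y := by rintro rfl; exact H.noty hz
  have hzE : z ∉ Fs G C y x := fun h => H.disj h hz
  have hyS : y ∈ C.erase z := by simp [H.hy, hzy.symm]
  have hxS : x ∈ C.erase z := by simp [H.hx, hzm.1.symm]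
  have hY := H.star z hzm.2.1 hvz y hyS
  have hyY : y ∈ comp G (C.erase z) y := self_comp hyS
  have hsub : Fs G C y x ⊆ comp G (C.erase z) y := Fs_G1 H.hB H.hy hzE hzy
  have hf := H.symm.card_F
  have hh := H.hh
  have hyn := H.symm.notx
  have hxn := H.symm.noty
  by_cases hR : ∀ r ∈ C, r ≠ x → r ≠ y → r ∉ Fs G C x y → r ∈ Fs G C y x
  · have hxY : x ∈ comp G (C.erase z) y := comp_cl hyY hxS (H.adj_xy hR).symm
    have h2 : (insert x (insert y (Fs G C y x))).card ≤ (comp G (C.erase z) y).card := by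
      apply Finset.card_le_card
      intro t ht
      simp at ht
      rcases ht with rfl | rfl | ht
      · exact hxY
      · exact hyY
      · exact hsub ht
    have hxn' : x ∉ insert y (Fs G C y x) := by simp [hxn, H.hxy]
    have h3 : (insert x (insert y (Fs G C y x))).card = (Fs G C y x).card + 2 := by
      rw [Finset.card_insert_of_notMem hxn', Finset.card_insert_of_notMem hyn]
    refine ⟨by omega, fun w hw hwz hxw => ?_⟩
    have hwm := mem_Fs.1 hw
    have hwY : w ∈ comp G (C.erase z) y := comp_cl hxY (by simp [hwz, hwm.2.1]) hxw
    have hwn : w ∉ insert x (insert y (Fs G C y x)) := by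
      simp only [Finset.mem_insert, not_or]
      refine ⟨hwm.1, ?_, fun h => H.disj h hw⟩
      rintro rfl; exact H.noty hw
    have h4 : (insert w (insert x (insert y (Fs G C y x)))).card ≤ (comp G (C.erase z) y).card := by
      apply Finset.card_le_card
      intro t ht
      simp at ht
      rcases ht with rfl | rfl | rfl | ht
      · exact hwY
      · exact hxY
      · exact hyY
      · exact hsub ht
    rw [Finset.card_insert_of_notMem hwn] at h4
    omega
  · exfalso
    push Not at hR
    obtain ⟨r, hr, hrx, hry, hr1, hr2⟩ := hR
    obtain ⟨hrx', hry'⟩ := H.rest hr hrx hry hr1 hr2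
    have hrz : r ≠ z := by rintro rfl; exact hr1 hz
    have hrY : r ∈ comp G (C.erase z) y := comp_cl hyY (by simp [hr, hrz]) hry'.symm
    have hxY : x ∈ comp G (C.erase z) y := comp_cl hrY hxS hrx'
    have hxn' : x ∉ insert y (Fs G C y x) := by simp [hxn, H.hxy]
    have hwn : r ∉ insert x (insert y (Fs G C y x)) := by
      simp only [Finset.mem_insert, not_or]
      exact ⟨hrx, hry, hr2⟩
    have h4 : (insert r (insert x (insert y (Fs G C y x)))).card ≤ (comp G (C.erase z) y).card := by
      apply Finset.card_le_card
      intro t ht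
      simp at ht
      rcases ht with rfl | rfl | rfl | ht
      · exact hrY
      · exact hxY
      · exact hyY
      · exact hsub ht
    rw [Finset.card_insert_of_notMem hwn, Finset.card_insert_of_notMem hxn', Finset.card_insert_of_notMem hyn] at h4
    omega

/-- small part: every vertex is adjacent to both outside vertices. -/
theorem UC.full {h : ℕ} {v x y : V} {C : Finset V} (H : UC G h v C x y) (hs : (Fs G C x y).card ≤ h - 1) {a : V} (ha : a ∈ Fs G C x y) : G.Adj a x ∧ G.Adj a v := by
  have hh := H.hh
  have key : ∀ s : V, (∀ b, G.Adj a b → b ∈ insert s ((Fs G C x y).erase a)) → False := by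
    intro s hs'
    have := deg_le_of hs'
    have := H.hδ a
    have := Finset.card_insert_le s ((Fs G C x y).erase a)
    have := Finset.card_erase_add_one ha
    omega
  constructor
  · by_contra hn
    refine key v (fun b hb => ?_)
    have := hb.ne
    rcases Fs_nb H.hB ha hb with h | h | h
    · simp [h]
    · subst h; exact absurd hb hn
    · simp [h, this.symm]
  · by_contra hn
    refine key x (fun b hb => ?_)
    have := hb.ne
    rcases Fs_nb H.hB ha hb with h | h | h
    · subst h; exact absurd hb hn
    · simp [h]
    · simp [h, this.symm]

theorem UC.nov {h : ℕ} {v x y : V} {C : Finset V} (H : UC G h v C x y) {z : V} (hz : z ∈ Fs G C x y) : ¬ G.Adj v z := by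
  intro hvz
  have hh := H.hh
  obtain ⟨h1, h2⟩ := H.U1 hz hvz
  have hf := H.card_F
  have hf' := H.symm.card_F
  obtain ⟨e, he⟩ : (Fs G C y x).Nonempty := by rw [← Finset.card_pos]; omega
  obtain ⟨h3, -⟩ := H.symm.U1 he (H.symm.full h1 he).2.symm
  obtain ⟨w, hw, hwz⟩ := Finset.exists_mem_ne (show 1 < (Fs G C x y).card by omega) z
  exact h2 w hw hwz (H.full h3 hw).1.symm

theorem UC.card_ge {h : ℕ} {v x y : V} {C : Finset V} (H : UC G h v C x y) : h ≤ (Fs G C x y).card := by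
  have hf := H.card_F
  have hh := H.hh
  obtain ⟨e, he⟩ : (Fs G C x y).Nonempty := by rw [← Finset.card_pos]; omega
  by_contra hcon
  exact H.nov he (H.full (by omega) he).2.symm

theorem UC.final {h : ℕ} {v x y : V} {C : Finset V} (H : UC G h v C x y) : G.Adj x y ∧ (Fs G C x y).card = h ∧ (Fs G C y x).card = h ∧
    (∀ r ∈ C, r ≠ x → r ≠ y → r ∉ Fs G C x y → r ∈ Fs G C y x) := by
  have h1 := H.card_ge
  have h2 := H.symm.card_ge
  have h3 := H.rest_card
  have h4 := H.symm.rest_card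
  have h5 : ∀ r ∈ C, r ≠ x → r ≠ y → r ∉ Fs G C x y → r ∈ Fs G C y x := by
    intro r hr hrx hry hr1
    by_contra hr2
    have hrR : r ∈ ((((C.erase x).erase y) \ Fs G C x y) \ Fs G C y x) := by simp; tauto
    have := Finset.card_pos.2 ⟨r, hrR⟩
    omega
  exact ⟨H.adj_xy h5, by omega, by omega, h5⟩

theorem UC.clique {h : ℕ} {v x y : V} {C : Finset V} (H : UC G h v C x y) {a b : V} (ha : a ∈ insert x (Fs G C x y)) (hb : b ∈ insert x (Fs G C x y)) (hab : a ≠ b) : G.Adj a b := by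
  have hc := H.final.2.1
  have key : ∀ a ∈ Fs G C x y, ∀ b ∈ insert x (Fs G C x y), a ≠ b → G.Adj a b := by
    intro a ha b hb hab
    by_contra hn
    have h1 : G.degree a ≤ (((insert x (Fs G C x y)).erase b).erase a).card := deg_le_of (fun t ht => by
      have := ht.ne
      have htb : t ≠ b := by rintro rfl; exact hn ht
      rcases Fs_nb H.hB ha ht with h | h | h
      · subst h; exact absurd ht.symm (H.nov ha)
      · subst h; simp [htb, this.symm]
      · simp [h, htb, this.symm])
    have h2 := Finset.card_erase_add_one hb
    have h3 := Finset.card_erase_add_one (s := (insert x (Fs G C x y)).erase b) (a := a) (by simp [hab, ha])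
    have h4 := Finset.card_insert_le x (Fs G C x y)
    have h5 := H.hδ a
    omega
  rcases Finset.mem_insert.1 ha with rfl | ha'
  · rcases Finset.mem_insert.1 hb with rfl | hb'
    · exact absurd rfl hab
    · exact (key b hb' a ha hab.symm).symm
  · exact key a ha' b hb hab

theorem U_iso' {h : ℕ} (B : Fin 3 → Finset V) (sp : Fin 3 → V) (hsp : ∀ i, sp i ∈ B i)
    (hcov : ∀ x, ∃ i, x ∈ B i) (hdis : ∀ i j x, x ∈ B i → x ∈ B j → i = j) (hcard : ∀ i, (B i).card = h + 1)
    (hcl : ∀ i, ∀ a ∈ B i, ∀ b ∈ B i, a ≠ b → G.Adj a b)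
    (hout : ∀ i, ∀ a ∈ B i, ∀ b, G.Adj a b → b ∉ B i → a = sp i)
    (hadj : ∀ i j, i ≠ j → G.Adj (sp i) (sp j)) : Nonempty (G ≃g Ugraph h) := by
  choose ι hι using hcov
  have hiff : ∀ x i, ι x = i ↔ x ∈ B i := fun x i =>
    ⟨fun h => h ▸ hι x, fun h => hdis _ _ x (hι x) h⟩
  refine U_iso ι sp (fun i => (hiff _ _).2 (hsp i)) (fun i => ?_) (fun x y hxy => ?_)
  · rw [← hcard i]; congr 1; ext x; simp [hiff]
  · constructor
    · intro ha
      by_cases he : ι x = ι y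
      · exact Or.inl he
      · right
        exact ⟨hout _ x (hι x) y ha (fun h => he (hdis _ _ y h (hι y))),
          hout _ y (hι y) x ha.symm (fun h => he (hdis _ _ x (hι x) h))⟩
    · rintro (he | ⟨h1, h2⟩)
      · exact hcl _ x (hι x) y (he ▸ hι y) hxy
      · by_cases he : ι x = ι y
        · exact hcl _ x (hι x) y (he ▸ hι y) hxy
        · rw [h1, h2]; exact hadj _ _ he

theorem U_final {h : ℕ} {v x y : V} {C D : Finset V} (H : UC G h v C x y) (hD : Br G v D) (hDc : D.card = h)
    (hDcl : ∀ a ∈ insert v D, ∀ b ∈ insert v D, a ≠ b → G.Adj a b) (hCD : Disjoint C D)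
    (hall : ∀ z, z = v ∨ z ∈ C ∨ z ∈ D) : Nonempty (G ≃g Ugraph h) := by
  obtain ⟨hxy, hF, hE, hR⟩ := H.final
  have hnv := H.hB.nv
  have hFC : ∀ a ∈ Fs G C x y, a ∈ C := fun a ha => (mem_Fs.1 ha).2.1
  have hEC : ∀ a ∈ Fs G C y x, a ∈ C := fun a ha => (mem_Fs.1 ha).2.1
  have hCD' : ∀ a ∈ C, a ∉ D := fun a ha hd => Finset.disjoint_left.1 hCD ha hd
  have hxC := H.hx
  have hyC := H.hy
  have hxF := H.notx
  have hyF := H.noty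
  have hyE := H.symm.notx
  have hxE := H.symm.noty
  have hne := H.hxy
  have hd : ∀ a ∈ Fs G C x y, a ∉ Fs G C y x := fun a ha h => H.disj h ha
  have d01 : ∀ a, a ∈ insert v D → a ∈ insert x (Fs G C x y) → False := by
    intro a; simp only [Finset.mem_insert]; grind
  have d02 : ∀ a, a ∈ insert v D → a ∈ insert y (Fs G C y x) → False := by
    intro a; simp only [Finset.mem_insert]; grind
  have d12 : ∀ a, a ∈ insert x (Fs G C x y) → a ∈ insert y (Fs G C y x) → False := by
    intro a; simp only [Finset.mem_insert]; grind
  refine U_iso' (h := h) ![insert v D, insert x (Fs G C x y), insert y (Fs G C y x)] ![v, x, y] ?_ ?_ ?_ ?_ ?_ ?_ ?_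
  · intro i; fin_cases i <;> simp
  · intro z
    by_cases h1 : z ∈ insert v D
    · exact ⟨0, h1⟩
    by_cases h2 : z ∈ insert x (Fs G C x y)
    · exact ⟨1, h2⟩
    refine ⟨2, ?_⟩
    show z ∈ insert y (Fs G C y x)
    simp only [Finset.mem_insert] at h1 h2 ⊢
    have := hall z
    have := hR z
    tauto
  · intro i j z
    fin_cases i <;> fin_cases j
    · intros; rfl
    · intro h1 h2; exact (d01 z h1 h2).elim
    · intro h1 h2; exact (d02 z h1 h2).elim
    · intro h1 h2; exact (d01 z h2 h1).elim
    · intros; rfl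
    · intro h1 h2; exact (d12 z h1 h2).elim
    · intro h1 h2; exact (d02 z h2 h1).elim
    · intro h1 h2; exact (d12 z h2 h1).elim
    · intros; rfl
  · intro i
    fin_cases i
    · show (insert v D).card = h + 1
      rw [Finset.card_insert_of_notMem hD.nv, hDc]
    · show (insert x (Fs G C x y)).card = h + 1
      rw [Finset.card_insert_of_notMem hxF, hF]
    · show (insert y (Fs G C y x)).card = h + 1
      rw [Finset.card_insert_of_notMem hyE, hE]
  · intro i
    fin_cases i
    · exact hDcl
    · intro a ha b hb; exact H.clique ha hb
    · intro a ha b hb; exact H.symm.clique ha hb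
  · have gen : ∀ {x y : V}, UC G h v C x y → ∀ a ∈ insert x (Fs G C x y), ∀ b, G.Adj a b → b ∉ insert x (Fs G C x y) → a = x := by
      intro x y H a ha b hab hb
      rcases Finset.mem_insert.1 ha with h | h
      · exact h
      · exfalso
        rcases Fs_nb H.hB h hab with h' | h' | h'
        · subst h'; exact H.nov h hab.symm
        · exact hb (by simp [h'])
        · exact hb (by simp [h'])
    intro i
    fin_cases i
    · show ∀ a ∈ insert v D, ∀ b, G.Adj a b → b ∉ insert v D → a = v
      intro a ha b hab hb
      rcases Finset.mem_insert.1 ha with h | h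
      · exact h
      · exact absurd (Finset.mem_insert.2 (hD.cl a h b hab)) hb
    · exact gen H
    · exact gen H.symm
  · intro i j hij
    fin_cases i <;> fin_cases j
    · exact absurd rfl hij
    · exact H.hvx
    · exact H.hvy
    · exact H.hvx.symm
    · exact absurd rfl hij
    · exact hxy
    · exact H.hvy.symm
    · exact hxy.symm
    · exact absurd rfl hij

end helpers6
section helpers7
variable {V : Type*} [Fintype V] [DecidableEq V] {G : SimpleGraph V} [DecidableRel G.Adj]

theorem mainB {h : ℕ} (hh : h = 3 ∨ 5 ≤ h)
    (hconn : G.Connected) (hcard : 2 * h + 4 ≤ Fintype.card V)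
    (hδ : ∀ v, h ≤ G.degree v) {v x0 y0 : V} (hx0 : x0 ≠ v) (hy0 : y0 ≠ v)
    (hxy0 : comp G (Finset.univ.erase v) x0 ≠ comp G (Finset.univ.erase v) y0) :
    ContainsForest G ![h + 2, h + 2] ∨
    (∃ v, ∀ z, z ≠ v → (comp G (Finset.univ.erase v) z).card ≤ h + 1) ∨ Nonempty (G ≃g Ugraph h) := by
  by_cases hbig : ∃ v, ∀ z, z ≠ v → (comp G (Finset.univ.erase v) z).card ≤ h + 1
  · exact Or.inr (Or.inl hbig)
  push Not at hbig
  by_cases hCF : ContainsForest G ![h + 2, h + 2]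
  · exact Or.inl hCF
  right; right
  obtain ⟨z, hz, hzc⟩ := hbig v
  have bz := Br_comp hconn hz
  have hw : ∃ w, w ≠ v ∧ comp G (Finset.univ.erase v) w ≠ comp G (Finset.univ.erase v) z := by
    by_cases hzx : comp G (Finset.univ.erase v) x0 = comp G (Finset.univ.erase v) z
    · exact ⟨y0, hy0, fun he => hxy0 (hzx.trans he.symm)⟩
    · exact ⟨x0, hx0, hzx⟩
  obtain ⟨w, hw, hwz⟩ := hw
  have bw := Br_comp hconn hw
  have hC2 : HasP G (comp G (Finset.univ.erase v) z) (h + 2) := by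
    rcases dirac bz.cc (fun a ha => bz.deg' hδ ha) with h | h
    · exact h.le (by omega)
    · exact h.le (by omega)
  have h3 : ∀ u, u ≠ v → comp G (Finset.univ.erase v) u = comp G (Finset.univ.erase v) w ∨
        comp G (Finset.univ.erase v) u = comp G (Finset.univ.erase v) z := by
    by_contra hcon
    push Not at hcon
    obtain ⟨u, hu, huw, huz⟩ := hcon
    have bu := Br_comp hconn hu
    have p := join2 (comp_disj huw) bu.nv bw.nv (branch_path (by omega) hδ bu).1 (branch_path (by omega) hδ bw).1
    refine hCF (CF ?_ (p.le (by omega)) hC2)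
    rw [Finset.disjoint_insert_left, Finset.disjoint_union_left]
    exact ⟨bz.nv, (comp_disj huz), (comp_disj hwz)⟩
  have hCD := (comp_disj hwz).symm
  have hall : ∀ u, u = v ∨ u ∈ comp G (Finset.univ.erase v) z ∨ u ∈ comp G (Finset.univ.erase v) w := by
    intro u
    by_cases hu : u = v
    · exact Or.inl hu
    · have hself := self_comp (G := G) (S := Finset.univ.erase v) (x := u) (by simp [hu])
      rcases h3 u hu with he | he <;> rw [he] at hself <;> tauto
  generalize comp G (Finset.univ.erase v) z = C at *
  generalize comp G (Finset.univ.erase v) w = D at *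
  clear h3 hwz
  obtain ⟨pD, pD'⟩ := branch_path (by omega) hδ bw
  have hd2 : Disjoint C (insert v D) := by
    rw [Finset.disjoint_insert_right]; exact ⟨bz.nv, hCD⟩
  have hDD : D.card = h ∧ ∀ a ∈ insert v D, ∀ b ∈ insert v D, a ≠ b → G.Adj a b := by
    rcases pD' with hD | hD
    · exact absurd (CF hd2 hC2 hD.toP) hCF
    · exact hD
  obtain ⟨hDc, hDcl⟩ := hDD
  have hCc : h + 3 ≤ C.card := by
    have hsub : Finset.univ ⊆ insert v (C ∪ D) := by
      intro u _
      rcases hall u with h | h | h <;> simp [h]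
    have h1 := Finset.card_le_card hsub
    have h2 := Finset.card_insert_le v (C ∪ D)
    have h3 := Finset.card_union_le C D
    rw [Finset.card_univ] at h1
    omega
  have hNP : ∀ x ∈ C, G.Adj v x → ¬ HasP G (C.erase x) (h + 2) := by
    intro x hx hvx hP
    obtain ⟨m, hm, hml⟩ := pD
    have hxn : x ∉ insert v D := Finset.disjoint_left.1 hd2 hx
    have hp : PathIn G (insert x (insert v D)) (x :: v :: m) :=
      PathIn.cons (hm.mono (Finset.subset_insert _ _)) (by simp) (fun h => hxn (hm.2.2 x h)) hvx.symm
    refine hCF (CF ?_ hP ⟨_, hp, by simp [hml]⟩)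
    rw [Finset.disjoint_insert_right]
    exact ⟨by simp, hd2.mono_left (Finset.erase_subset _ _)⟩
  have hCv : ∀ t ∈ C, t ≠ v := by rintro t ht rfl; exact bz.nv ht
  obtain ⟨x, hx, hvx⟩ := bz.nb
  by_cases hy : ∃ y ∈ C, y ≠ x ∧ G.Adj v y
  · obtain ⟨y, hy, hyx, hvy⟩ := hy
    refine U_final (x := x) (y := y) ⟨by omega, hδ, bz, ?_, hCc, hx, hy, hyx.symm, hvx, hvy⟩ bw hDc hDcl hCD hall
    intro t ht hvt u hu
    by_contra hcon
    push Not at hcon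
    have hEsub := comp_sub (G := G) (S := C.erase t) (x := u)
    have hcl : ∀ a ∈ comp G (C.erase t) u, ∀ b, G.Adj a b → b = t ∨ b = v ∨ b ∈ comp G (C.erase t) u := by
      intro a ha b hab
      by_cases hbt : b = t
      · exact Or.inl hbt
      · rcases bz.cl a (Finset.mem_of_mem_erase (hEsub ha)) b hab with h | h
        · exact Or.inr (Or.inl h)
        · exact Or.inr (Or.inr (comp_cl ha (by simp [h, hbt]) hab))
    rcases hh with rfl | h5
    · exact star3 hδ (comp_cc hu) hEsub bz.nv ht hcl (by omega) hvt hNP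
    · refine hNP t ht hvt (HasP.mono ?_ hEsub)
      have hdeg : ∀ a ∈ comp G (C.erase t) u, h - 2 ≤ dIn G (comp G (C.erase t) u) a := by
        intro a ha
        have h1 : G.degree a ≤ (insert t (insert v ((comp G (C.erase t) u).filter (G.Adj a)))).card :=
          deg_le_of (fun b hb => by
            rcases hcl a ha b hb with h | h | h <;> simp [h, hb])
        have h2 := Finset.card_insert_le v ((comp G (C.erase t) u).filter (G.Adj a))
        have h2' := Finset.card_insert_le t (insert v ((comp G (C.erase t) u).filter (G.Adj a)))
        have h3 := hδ a
        unfold dIn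
        omega
      rcases dirac (comp_cc hu) hdeg with h | h
      · exact h.le (by omega)
      · exact h.le (by omega)
  · exfalso
    push Not at hy
    obtain ⟨s, hs, hsc⟩ := hbig x
    have bE := Br_comp hconn hs
    generalize comp G (Finset.univ.erase x) s = E at *
    have hEsub : E ⊆ C.erase x := by
      intro t ht
      rw [Finset.mem_erase]
      refine ⟨by rintro rfl; exact bE.nv ht, ?_⟩
      by_contra htC
      have htD : t ∈ insert v D := by
        rcases hall t with h | h | h
        · simp [h]
        · exact absurd h htC
        · simp [h]
      have : E ⊆ insert v D := by
        by_contra hcon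
        obtain ⟨a, ha, b, hb, hbA, hab⟩ := bE.cc.2 (E ∩ insert v D) Finset.inter_subset_left
          ⟨t, Finset.mem_inter.2 ⟨ht, htD⟩⟩ (fun he => hcon (Finset.inter_eq_left.1 he))
        rw [Finset.mem_inter] at ha hbA
        have hbn : b ∉ insert v D := fun h => hbA ⟨hb, h⟩
        rcases Finset.mem_insert.1 ha.2 with rfl | haD
        · have hbC : b ∈ C := by
            rcases hall b with h | h | h
            · exact absurd (by simp [h]) hbn
            · exact h
            · exact absurd (by simp [h]) hbn
          have hbx : b ≠ x := by rintro rfl; exact bE.nv hb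
          exact hy b hbC hbx hab
        · exact hbn (Finset.mem_insert.2 (bw.cl a haD b hab))
      have h1 := Finset.card_le_card this
      have h2 := Finset.card_insert_le v D
      omega
    refine hNP x hx hvx (HasP.mono ?_ hEsub)
    rcases dirac bE.cc (fun a ha => bE.deg' hδ ha) with h | h
    · exact h.le (by omega)
    · exact h.le (by omega)

end helpers7

theorem stmt_19 {V : Type*} [Fintype V] [DecidableEq V] (G : SimpleGraph V)
    [DecidableRel G.Adj] (h b₁ b₂ : ℕ) (hb : b₂ ≤ b₁) (hb1 : 1 ≤ b₂)
    (hsum : b₁ + b₂ = h + 1) (hh : 3 ≤ h)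
    (hconn : G.Connected) (hcard : 2 * h + 4 ≤ Fintype.card V)
    (hδ : ∀ v, h ≤ G.degree v)
    (hcut : ∃ v : V, ¬ (G.induce {u | u ≠ v}).Connected) :
    ContainsForest G ![2 * b₁ + 1, 2 * b₂ + 1] ∨
    (b₁ = b₂ + 1 ∧ ∃ t, Fintype.card V = t * h + 1 ∧ Nonempty (G ≃g Lgen t 0 h)) ∨
    (b₁ = b₂ ∧
      (Nonempty (G ≃g Ugraph h) ∨
       (∃ t₁ t₂, Fintype.card V = t₁ * h + t₂ * (h + 1) + 1 ∧
          SubgraphOf G (Lgen t₁ t₂ h)) ∨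
       (∃ t₁ t₂, Fintype.card V = t₁ * h + (t₂ + 1) * (h + 1) + 1 ∧
          SubgraphOf G (Fgraph t₁ t₂ h)) ∨
       (∃ t₁ t₂, Fintype.card V = t₁ * h + (t₂ + 2) * (h + 1) + 1 ∧
          SubgraphOf G (Tgraph t₁ t₂ h)))) := by
  obtain ⟨v, hv⟩ := hcut
  obtain ⟨x, y, hx, hy, hxy⟩ := two_comps (by omega) hv
  by_cases hbb : b₁ = b₂
  · subst hbb
    have e : 2 * b₁ + 1 = h + 2 := by omega
    rw [e]
    rcases mainB (by omega) hconn hcard hδ hx hy hxy with h1 | ⟨c, hc⟩ | h1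
    · exact Or.inl h1
    · refine Or.inr (Or.inr ⟨rfl, Or.inr (Or.inl ?_)⟩)
      refine L_sub (by omega) c (fun z hz => ?_)
      have h1 := (Br_comp hconn hz).card_ge hδ
      have h2 := hc z hz
      omega
    · exact Or.inr (Or.inr ⟨rfl, Or.inl h1⟩)
  · rcases mainA (a := 2 * b₁ + 1) (c := 2 * b₂ + 1) hh (by omega) (by omega) (by omega) (by omega) hconn hcard hδ hx hy hxy with h1 | ⟨h1, h2⟩
    · exact Or.inl h1
    · exact Or.inr (Or.inl ⟨by omega, L_iso (by omega) v h2⟩)
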